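/- arXiv:1403.3427 — 5 statements merged into one kernel-verified Lean document; each statement's English description precedes it below -/
import Mathlib

section
/- Let A be a nonempty finite subset of an additive abelian group G and let K ≥ 1 be a real number. If E(A,A) ≥ |A|³/K, then there exists a subset A' ⊆ A such that |A'| ≥ |A|/(20K) and |A'−A'| ≤ 10⁷·K⁹·|A|. -/
open scoped BigOperators Pointwise

/-- The additive energy `E(A,B)`: the number of quadruples `(a₁,a₂,b₁,b₂) ∈ A×A×B×B`
with `a₁+b₁ = a₂+b₂`. -/
def addEnergy {G : Type*} [AddCommGroup G] [DecidableEq G] (A B : Finset G) : ℕ :=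
  (((A ×ˢ A) ×ˢ B ×ˢ B).filter fun q => q.1.1 + q.2.1 = q.1.2 + q.2.2).card

open Finset in
theorem card_mul_le_card_of_le_card_fiber {α β : Type*} [DecidableEq β] (f : α → β)
    (s : Finset α) (t : Finset β) (m : ℝ) (h : ∀ b ∈ t, m ≤ (#{a ∈ s | f a = b} : ℝ)) :
    (#t : ℝ) * m ≤ #s := by
  have h₁ : ∑ b ∈ t, #{a ∈ s | f a = b} ≤ #s := by
    rw [sum_card_fiberwise_eq_card_filter]
    exact card_filter_le _ _
  calc (#t : ℝ) * m = ∑ _b ∈ t, m := by simp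
    _ ≤ ∑ b ∈ t, (#{a ∈ s | f a = b} : ℝ) := sum_le_sum h
    _ ≤ #s := by exact_mod_cast h₁

section DependentRandomChoice

open Finset

variable {α : Type*}

/-- The common neighbours in `A` of `x` and `y`. -/
def commonNeighbors (A : Finset α) (R : α → α → Prop) [DecidableRel R] (x y : α) : Finset α :=
  {u ∈ A | R x u ∧ R y u}

/-- Dependent random choice: some neighbourhood `N` is large, and few of its pairs have few
common neighbours. -/
theorem exists_neighborhood_few_bad_pairs (A : Finset α) (hA : A.Nonempty)
    (R : α → α → Prop) [DecidableRel R] (δ : ℝ) (hδ : 0 < δ)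
    (h : δ * (#A : ℝ) ^ 2 ≤ #{p ∈ A ×ˢ A | R p.1 p.2}) :
    ∃ N ⊆ A, δ * #A / 2 ≤ #N ∧
      8 * (#{p ∈ N ×ˢ N | (#(commonNeighbors A R p.1 p.2) : ℝ) < δ ^ 2 * #A / 16} : ℝ)
        ≤ (#N : ℝ) ^ 2 := by
  set n : ℝ := (#A : ℝ) with hn
  have hn0 : 0 < n := by simpa [hn] using hA
  set N : α → Finset α := fun b => {a ∈ A | R a b} with hN
  set bad : Finset (α × α) :=
    {p ∈ A ×ˢ A | (#(commonNeighbors A R p.1 p.2) : ℝ) < δ ^ 2 * n / 16} with hbad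
  set B : α → Finset (α × α) := fun b => {p ∈ bad | R p.1 b ∧ R p.2 b} with hB
  have hBN (b : α) : {p ∈ N b ×ˢ N b |
      (#(commonNeighbors A R p.1 p.2) : ℝ) < δ ^ 2 * n / 16} = B b := by
    ext p
    simp only [hN, hB, hbad, mem_filter, mem_product]
    tauto
  have hedges : δ * n ^ 2 ≤ ∑ b ∈ A, (#(N b) : ℝ) := by
    refine h.trans (le_of_eq ?_)
    simp only [hN, card_filter, sum_product_right]
    push_cast
    rfl
  have hsq : δ ^ 2 * n ^ 3 ≤ ∑ b ∈ A, (#(N b) : ℝ) ^ 2 := by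
    have hcs : (∑ b ∈ A, (#(N b) : ℝ)) ^ 2 ≤ n * ∑ b ∈ A, (#(N b) : ℝ) ^ 2 :=
      sq_sum_le_card_mul_sum_sq
    have h₁ : (δ * n ^ 2) ^ 2 ≤ (∑ b ∈ A, (#(N b) : ℝ)) ^ 2 :=
      pow_le_pow_left₀ (by positivity) hedges 2
    refine le_of_mul_le_mul_left ?_ hn0
    calc n * (δ ^ 2 * n ^ 3) = (δ * n ^ 2) ^ 2 := by ring
      _ ≤ _ := h₁.trans hcs
  have hbadsum : ∑ b ∈ A, (#(B b) : ℝ) ≤ δ ^ 2 * n ^ 3 / 16 := by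
    have hswap : ∑ b ∈ A, (#(B b) : ℝ) =
        ∑ p ∈ bad, (#(commonNeighbors A R p.1 p.2) : ℝ) := by
      simp only [hB, commonNeighbors, card_filter]
      push_cast
      exact sum_comm
    have hcard : (#bad : ℝ) ≤ n ^ 2 := by
      have : #bad ≤ #A * #A := (card_filter_le _ _).trans (card_product A A).le
      rw [sq, hn]
      exact_mod_cast this
    rw [hswap]
    calc _ ≤ ∑ _p ∈ bad, δ ^ 2 * n / 16 := sum_le_sum fun p hp => (mem_filter.1 hp).2.le
      _ = #bad * (δ ^ 2 * n / 16) := by simp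
      _ ≤ n ^ 2 * (δ ^ 2 * n / 16) := by gcongr
      _ = _ := by ring
  obtain ⟨b, -, hb⟩ : ∃ b ∈ A, δ ^ 2 * n ^ 2 / 2 ≤ (#(N b) : ℝ) ^ 2 - 8 * #(B b) := by
    refine exists_le_of_sum_le hA ?_
    rw [sum_sub_distrib, ← mul_sum, sum_const, nsmul_eq_mul, ← hn]
    nlinarith
  have hδn : 0 < δ * n := by positivity
  refine ⟨N b, filter_subset _ _, ?_, ?_⟩
  · refine le_of_sq_le_sq ?_ (by positivity)
    have : (0 : ℝ) ≤ #(B b) := by positivity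
    nlinarith
  · rw [hBN]
    nlinarith [sq_nonneg (δ * n)]

/-- A dense relation contains a large set any two of whose elements are joined by many paths of
length four. -/
theorem exists_subset_many_paths [DecidableEq α] (A : Finset α) (hA : A.Nonempty)
    (R : α → α → Prop) [DecidableRel R] (δ : ℝ) (hδ : 0 < δ)
    (h : δ * (#A : ℝ) ^ 2 ≤ #{p ∈ A ×ˢ A | R p.1 p.2}) :
    ∃ A' ⊆ A, δ * #A / 4 ≤ #A' ∧ ∀ x ∈ A', ∀ x' ∈ A',
      δ * #A / 4 * (δ ^ 2 * #A / 16) ^ 2 ≤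
        (#{t ∈ A ×ˢ A ×ˢ A | R x t.2.1 ∧ R t.1 t.2.1 ∧ R t.1 t.2.2 ∧ R x' t.2.2} : ℝ) := by
  obtain ⟨N, hNA, hNcard, hNbad⟩ := exists_neighborhood_few_bad_pairs A hA R δ hδ h
  set n : ℝ := (#A : ℝ) with hn
  have hn0 : 0 < n := by simpa [hn] using hA
  have hN0 : (0 : ℝ) < #N := lt_of_lt_of_le (by positivity) hNcard
  set c : ℝ := δ ^ 2 * n / 16 with hc
  set bad : α → Finset α := fun x => {y ∈ N | (#(commonNeighbors A R x y) : ℝ) < c} with hbad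
  set A' : Finset α := {x ∈ N | (#(bad x) : ℝ) ≤ #N / 4} with hA'
  refine ⟨A', (filter_subset _ _).trans hNA, ?_, fun x hx x' hx' => ?_⟩
  · have hcount : (#{x ∈ N | ¬ (#(bad x) : ℝ) ≤ #N / 4} : ℝ) * (#N / 4) ≤
        (#{p ∈ N ×ˢ N | (#(commonNeighbors A R p.1 p.2) : ℝ) < c} : ℝ) := by
      refine card_mul_le_card_of_le_card_fiber Prod.fst _ _ _ fun x hx => ?_
      rw [mem_filter, not_le] at hx
      refine hx.2.le.trans (Nat.cast_le.2 ?_)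
      refine card_le_card_of_injOn (fun y => (x, y)) (fun y hy => ?_) (fun y _ z _ hyz => ?_)
      · simp_all
      · simpa using hyz
    have hsplit : (#A' : ℝ) + #{x ∈ N | ¬ (#(bad x) : ℝ) ≤ #N / 4} = #N := by
      exact_mod_cast card_filter_add_card_filter_not (s := N) (fun x => (#(bad x) : ℝ) ≤ #N / 4)
    nlinarith
  · have hY : (#N : ℝ) / 2 ≤ #(N \ (bad x ∪ bad x')) := by
      have h₁ : #N ≤ #(N \ (bad x ∪ bad x')) + (#(bad x) + #(bad x')) := by
        have := card_union_le (bad x) (bad x')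
        have := le_card_sdiff (bad x ∪ bad x') N
        omega
      have h₂ : (#N : ℝ) ≤ #(N \ (bad x ∪ bad x')) + (#(bad x) + #(bad x')) := by
        exact_mod_cast h₁
      have := (mem_filter.1 hx).2
      have := (mem_filter.1 hx').2
      linarith
    calc δ * n / 4 * c ^ 2 ≤ #(N \ (bad x ∪ bad x')) * c ^ 2 := by
          gcongr
          linarith
      _ ≤ _ := by
        refine card_mul_le_card_of_le_card_fiber Prod.fst _ _ _ fun y hy => ?_
        have hy' : y ∈ N ∧ c ≤ #(commonNeighbors A R x y) ∧ c ≤ #(commonNeighbors A R x' y) := by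
          simp only [hbad, mem_sdiff, mem_union, mem_filter, not_or, not_and, not_lt] at hy
          exact ⟨hy.1, hy.2.1 hy.1, hy.2.2 hy.1⟩
        calc c ^ 2 = c * c := sq c
          _ ≤ #(commonNeighbors A R x y) * #(commonNeighbors A R x' y) := by
            gcongr
            exacts [hy'.2.1, hy'.2.2]
          _ = (#(commonNeighbors A R x y ×ˢ commonNeighbors A R x' y) : ℝ) := by
            rw [card_product]
            push_cast
            rfl
          _ ≤ _ := by
            refine Nat.cast_le.2 (card_le_card_of_injOn (fun p => (y, p)) (fun p hp => ?_)
              (fun p _ q _ hpq => ?_))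
            · have := hNA hy'.1
              simp only [commonNeighbors, mem_coe, mem_filter, mem_product] at hp ⊢
              tauto
            · simpa using hpq

end DependentRandomChoice

section Differences

open Finset

variable {G : Type*} [AddCommGroup G] [DecidableEq G]

/-- The pairs in `A × A` whose difference is `d`. -/
def differencePairs (A : Finset G) (d : G) : Finset (G × G) :=
  {p ∈ A ×ˢ A | p.1 - p.2 = d}

theorem mem_differencePairs {A : Finset G} {d : G} {p : G × G} :
    p ∈ differencePairs A d ↔ p ∈ A ×ˢ A ∧ p.1 - p.2 = d :=
  mem_filter

theorem card_differencePairs_le (A : Finset G) (d : G) : #(differencePairs A d) ≤ #A := by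
  refine card_le_card_of_injOn Prod.fst (fun p hp => ?_) (fun p hp q hq hpq => ?_)
  · exact (mem_product.1 (mem_differencePairs.1 hp).1).1
  · have h := (mem_differencePairs.1 hp).2.trans (mem_differencePairs.1 hq).2.symm
    rw [hpq] at h
    exact Prod.ext hpq (sub_right_injective h)

theorem addEnergy_self_eq_sum (A : Finset G) :
    _root_.addEnergy A A = ∑ p ∈ A ×ˢ A, #(differencePairs A (p.1 - p.2)) := by
  rw [_root_.addEnergy, card_filter, sum_product, sum_product_right, sum_product]
  refine sum_congr rfl fun a _ => sum_congr rfl fun b _ => ?_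
  rw [differencePairs, card_filter]
  refine sum_congr rfl fun p _ => if_congr ?_ rfl rfl
  rw [sub_eq_sub_iff_add_eq_add, add_comm b, add_comm a, eq_comm]

/-- Pairs with a popular difference are plentiful when the energy is large. -/
theorem le_card_popular_pairs (A : Finset G) (hA : A.Nonempty) (δ : ℝ) (hδ : 0 ≤ δ)
    (hE : 2 * δ * (#A : ℝ) ^ 3 ≤ _root_.addEnergy A A) :
    δ * (#A : ℝ) ^ 2 ≤
      (#{p ∈ A ×ˢ A | δ * #A ≤ (#(differencePairs A (p.1 - p.2)) : ℝ)} : ℝ) := by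
  set n : ℝ := (#A : ℝ) with hn
  have hn0 : 0 < n := by simpa [hn] using hA
  set P : Finset (G × G) := {p ∈ A ×ˢ A | δ * n ≤ (#(differencePairs A (p.1 - p.2)) : ℝ)}
  have hsum : (_root_.addEnergy A A : ℝ) ≤ ∑ p ∈ A ×ˢ A, (δ * n + if p ∈ P then n else 0) := by
    rw [addEnergy_self_eq_sum, Nat.cast_sum]
    refine sum_le_sum fun p hp => ?_
    split_ifs with hpP
    · have := mul_nonneg hδ hn0.le
      have := (Nat.cast_le (α := ℝ)).2 (card_differencePairs_le A (p.1 - p.2))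
      linarith
    · rw [add_zero]
      by_contra! hlt
      exact hpP (mem_filter.2 ⟨hp, hlt.le⟩)
  have hP : (A ×ˢ A).filter (· ∈ P) = P := filter_mem_eq_inter.trans
    (inter_eq_right.2 (filter_subset _ _))
  rw [sum_add_distrib, ← sum_filter, hP, sum_const, sum_const, card_product, nsmul_eq_mul,
    nsmul_eq_mul, Nat.cast_mul, ← hn] at hsum
  refine le_of_mul_le_mul_right ?_ hn0
  linarith

/-- If any two elements of `A'` are joined by at least `T` paths of length four along `r`-popular
differences, then `A' - A'` is small. -/
theorem card_sub_mul_le_of_many_paths (A A' : Finset G) (r T : ℝ) (hr : 0 ≤ r)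
    (h : ∀ x ∈ A', ∀ x' ∈ A', T ≤ (#{t ∈ A ×ˢ A ×ˢ A |
      r ≤ (#(differencePairs A (x - t.2.1)) : ℝ) ∧ r ≤ (#(differencePairs A (t.1 - t.2.1)) : ℝ) ∧
      r ≤ (#(differencePairs A (t.1 - t.2.2)) : ℝ) ∧
      r ≤ (#(differencePairs A (x' - t.2.2)) : ℝ)} : ℝ)) :
    (#(A' - A') : ℝ) * (T * r ^ 4) ≤ (#A : ℝ) ^ 8 := by
  set Q := (A ×ˢ A) ×ˢ (A ×ˢ A) ×ˢ (A ×ˢ A) ×ˢ (A ×ˢ A) with hQ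
  have hQcard : (#Q : ℝ) = (#A : ℝ) ^ 8 := by
    simp only [hQ, card_product]
    push_cast
    ring
  rw [← hQcard]
  refine card_mul_le_card_of_le_card_fiber
    (fun q => (q.1.1 - q.1.2) - (q.2.1.1 - q.2.1.2) + (q.2.2.1.1 - q.2.2.1.2)
      - (q.2.2.2.1 - q.2.2.2.2)) _ _ _ fun d hd => ?_
  obtain ⟨x, hx, x', hx', rfl⟩ := mem_sub.1 hd
  refine (mul_le_mul_of_nonneg_right (h x hx x' hx') (by positivity)).trans ?_
  refine card_mul_le_card_of_le_card_fiber
    (fun q => (x - (q.1.1 - q.1.2) + (q.2.1.1 - q.2.1.2), x - (q.1.1 - q.1.2),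
      x' - (q.2.2.2.1 - q.2.2.2.2))) _ _ _ fun t ht => ?_
  obtain ⟨-, h₁, h₂, h₃, h₄⟩ := mem_filter.1 ht
  calc r ^ 4 = r * (r * (r * r)) := by ring
    _ ≤ #(differencePairs A (x - t.2.1)) * (#(differencePairs A (t.1 - t.2.1)) *
        (#(differencePairs A (t.1 - t.2.2)) * #(differencePairs A (x' - t.2.2)))) := by
      gcongr
    _ = (#(differencePairs A (x - t.2.1) ×ˢ differencePairs A (t.1 - t.2.1) ×ˢ
        differencePairs A (t.1 - t.2.2) ×ˢ differencePairs A (x' - t.2.2)) : ℝ) := by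
      simp only [card_product]
      push_cast
      rfl
    _ ≤ _ := by
      refine Nat.cast_le.2 (card_le_card fun q hq => ?_)
      simp only [mem_product (p := q), mem_product (p := q.2), mem_product (p := q.2.2),
        mem_differencePairs] at hq
      obtain ⟨⟨m₁, e₁⟩, ⟨m₂, e₂⟩, ⟨m₃, e₃⟩, m₄, e₄⟩ := hq
      simp only [mem_filter, hQ, e₁, e₂, e₃, e₄]
      refine ⟨⟨mem_product.2 ⟨m₁, mem_product.2 ⟨m₂, mem_product.2 ⟨m₃, m₄⟩⟩⟩, by abel⟩, ?_⟩
      ext <;> simp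

end Differences

theorem exists_subset_small_diffset_of_large_energy
    {G : Type*} [AddCommGroup G] [DecidableEq G] (A : Finset G) (hA : A.Nonempty)
    (K : ℝ) (hK : 1 ≤ K) (hE : (A.card : ℝ) ^ 3 / K ≤ (addEnergy A A : ℝ)) :
    ∃ A' ⊆ A, (A.card : ℝ) / (20 * K) ≤ (A'.card : ℝ) ∧
      ((A' - A').card : ℝ) ≤ 10 ^ 7 * K ^ 9 * (A.card : ℝ) := by
  have hK0 : 0 < K := by linarith
  have hn0 : (0 : ℝ) < A.card := by simpa using hA
  have hpop := le_card_popular_pairs A hA (1 / (2 * K)) (by positivity) (by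
    refine le_trans (le_of_eq ?_) hE
    field_simp)
  obtain ⟨A', hA'A, hcard, hpaths⟩ := exists_subset_many_paths A hA
    (fun a b => 1 / (2 * K) * (A.card : ℝ) ≤ ((differencePairs A (a - b)).card : ℝ))
    (1 / (2 * K)) (by positivity) hpop
  refine ⟨A', hA'A, le_trans ?_ hcard, ?_⟩
  · rw [div_mul_eq_mul_div, one_mul, div_div]
    exact div_le_div_of_nonneg_left hn0.le (by positivity) (by linarith)
  · have hdiff := card_sub_mul_le_of_many_paths A A' _ _ (by positivity) hpaths
    set n : ℝ := (A.card : ℝ)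
    have hT : 1 / (2 * K) * n / 4 * ((1 / (2 * K)) ^ 2 * n / 16) ^ 2 * (1 / (2 * K) * n) ^ 4 =
        n ^ 7 / (524288 * K ^ 9) := by
      field_simp
      norm_num
    rw [hT, mul_div_assoc', div_le_iff₀ (by positivity)] at hdiff
    have h₁ : ((A' - A').card : ℝ) ≤ 524288 * K ^ 9 * n := by
      refine le_of_mul_le_mul_right (hdiff.trans (le_of_eq ?_)) (pow_pos hn0 7)
      ring
    refine h₁.trans ?_
    gcongr
    norm_num
end

section
/- Let p be an odd prime and a₁,b₁,a₂,b₂ ∈ F_p with a₁ ≠ a₂. Then ⟨u_{a₁,b₁}, u_{a₂,b₂}⟩ = (σ_p/√p)·χ_p(a₁−a₂)·e_p(−(b₁−b₂)²/(4(a₁−a₂))), where ⟨u,v⟩ := Σ_{x∈F_p} u(x)·conj(v(x)), χ_p is the Legendre symbol mod p, σ_p = 1 if p ≡ 1 (mod 4) and σ_p = i if p ≡ 3 (mod 4), and the division by 4(a₁−a₂) is performed in the field F_p. -/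
open scoped BigOperators

/-- `e_p(t) = e^{2πit/p}` for `t ∈ F_p`. -/
noncomputable def ep (p : ℕ) (t : ZMod p) : ℂ :=
  Complex.exp (2 * Real.pi * Complex.I * (t.val : ℂ) / (p : ℂ))

/-- The chirp vector `u_{a,b} = p^{-1/2}(e_p(ax²+bx))_{x∈F_p}`. -/
noncomputable def chirp (p : ℕ) (a b : ZMod p) : ZMod p → ℂ :=
  fun x => ((Real.sqrt p)⁻¹ : ℝ) * ep p (a * x ^ 2 + b * x)

/-- The Legendre symbol `χ_p` as a complex-valued function on `F_p`. -/
noncomputable def chiLegendre (p : ℕ) [Fact p.Prime] (t : ZMod p) : ℂ :=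
  ((legendreSym p (t.val : ℤ) : ℤ) : ℂ)

/-- The normalized Gauss-sum constant: `σ_p = 1` if `p ≡ 1 (mod 4)`, `σ_p = i` if
`p ≡ 3 (mod 4)`. -/
noncomputable def sigmaP (p : ℕ) : ℂ := if p % 4 = 1 then 1 else Complex.I

open Polynomial in
/-- The Euler operator, sending a polynomial to `X` times its derivative. -/
noncomputable def eulerOp (R : Type*) [CommRing R] : Module.End R R[X] :=
  (LinearMap.mulLeft R X) ∘ₗ derivative

open Polynomial in
theorem eulerOp_apply {R : Type*} [CommRing R] (q : R[X]) :
    eulerOp R q = X * derivative q := rfl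

open Polynomial in
theorem eulerOp_pow_X_pow {R : Type*} [CommRing R] (n j : ℕ) :
    (eulerOp R ^ n) (X ^ j) = C ((j : R) ^ n) * X ^ j := by
  induction n with
  | zero => simp
  | succ n ih =>
    rw [pow_succ', Module.End.mul_apply, ih, eulerOp_apply]
    rw [derivative_C_mul, derivative_X_pow]
    rcases j with _ | j
    · simp
    · simp only [Nat.add_sub_cancel, map_pow, map_natCast]
      ring

open Polynomial in
theorem eval_one_eulerOp_pow {R : Type*} [CommRing R] (n : ℕ) (q : R[X]) :
    ((eulerOp R ^ n) ((X - 1) ^ n * q)).eval 1 = (n.factorial : R) * q.eval 1 := by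
  induction n generalizing q with
  | zero => simp
  | succ n ih =>
    have h : eulerOp R ((X - 1) ^ (n + 1) * q) =
        (X - 1) ^ n * (X * (C ((n : R) + 1) * q + (X - 1) * derivative q)) := by
      rw [eulerOp_apply, derivative_mul, derivative_pow]
      simp
      ring
    rw [pow_succ, Module.End.mul_apply, h, ih]
    simp [Nat.factorial_succ]
    ring

open Polynomial in
theorem X_pow_sub_X_pow_eq {R : Type*} [CommRing R] (a b : ℕ) :
    (X ^ a - X ^ b : R[X]) =
      (X - 1) * (∑ i ∈ Finset.range a, X ^ i - ∑ i ∈ Finset.range b, X ^ i) := by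
  rw [mul_sub, mul_geom_sum, mul_geom_sum]
  ring

/-- `((p-1)/2)!² = (-1)^((p+1)/2)` modulo `p`. -/
theorem factorial_half_sq {p m : ℕ} [Fact p.Prime] (hm : p = 2 * m + 1) :
    ((m.factorial : ZMod p)) ^ 2 = (-1) ^ (m + 1) := by
  have hp0 : (2 * m + 1 : ZMod p) = 0 := by
    have h : ((2 * m + 1 : ℕ) : ZMod p) = 0 := by rw [← hm]; simp
    exact_mod_cast h
  have h1 : (((m + m).factorial : ℕ) : ZMod p) = -1 := by
    have := ZMod.wilsons_lemma p
    rwa [show p - 1 = m + m by omega] at this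
  rw [← Nat.factorial_mul_ascFactorial, Nat.ascFactorial_eq_prod_range] at h1
  have h2 : (∏ i ∈ Finset.range m, ((m + 1 + i : ℕ) : ZMod p)) = (-1) ^ m * m.factorial := by
    rw [← Finset.prod_range_add_one_eq_factorial, Nat.cast_prod,
      ← Finset.prod_range_reflect (fun i => ((i + 1 : ℕ) : ZMod p))]
    conv_rhs => rw [← Finset.card_range m, ← Finset.prod_const, Finset.card_range]
    rw [← Finset.prod_mul_distrib]
    refine Finset.prod_congr rfl fun i hi => ?_
    have := Finset.mem_range.1 hi
    rw [show m - 1 - i + 1 = m - i by omega, Nat.cast_sub this.le]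
    push_cast
    linear_combination hp0
  push_cast at h1 h2
  rw [h2] at h1
  have h3 : ((-1 : ZMod p) ^ m) * (-1) ^ m = 1 := by rw [← mul_pow]; simp
  rw [pow_succ (-1 : ZMod p)]
  linear_combination (-1) ^ m * h1 - (m.factorial : ZMod p) ^ 2 * h3

open Polynomial in
/-- If the quadratic Gauss sum is `ε` times the product of the differences `η^k - η^(p-k)`,
then `ε = (-1)^((p-1)/2)`, at least modulo `p`. -/
theorem gauss_sign_mod {p m : ℕ} [Fact p.Prime] (hm : p = 2 * m + 1) {η : ℂ}
    (hη : IsPrimitiveRoot η p) (ε : ℤ)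
    (h : ∑ x : ZMod p, η ^ (2 * x ^ 2).val =
      ε * ∏ k ∈ Finset.range m, (η ^ (k + 1) - η ^ (p - (k + 1)))) :
    (ε : ZMod p) = (-1) ^ m := by
  have hpp : p.Prime := Fact.out
  have hm0 : 0 < m := by have := hpp.two_le; omega
  set f : ℤ[X] := ∑ x : ZMod p, X ^ (2 * x ^ 2).val -
    C ε * ∏ k ∈ Finset.range m, (X ^ (k + 1) - X ^ (p - (k + 1))) with hf
  have hdvd : cyclotomic p ℤ ∣ f := by
    rw [cyclotomic_eq_minpoly hη hpp.pos]
    apply minpoly.isIntegrallyClosed_dvd (hη.isIntegral hpp.pos)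
    simp [hf, h]
  have hdvd' : (X - 1 : (ZMod p)[X]) ^ (p - 1) ∣ f.map (Int.castRingHom (ZMod p)) := by
    have h1 := Polynomial.map_dvd (Int.castRingHom (ZMod p)) hdvd
    rw [map_cyclotomic] at h1
    have h2 : cyclotomic p (ZMod p) = (X - 1) ^ (p - 1) := by
      have := cyclotomic_mul_prime_eq_pow_of_not_dvd (ZMod p) (p := p) (n := 1)
        (by simpa using hpp.one_lt.ne')
      simpa using this
    rwa [h2] at h1
  obtain ⟨g, hg⟩ := hdvd'
  have hg' : f.map (Int.castRingHom (ZMod p)) = (X - 1) ^ m * ((X - 1) ^ m * g) := by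
    rw [hg, show p - 1 = m + m by omega, pow_add, mul_assoc]
  have hQ : (∏ k ∈ Finset.range m, (X ^ (k + 1) - X ^ (p - (k + 1))) : (ZMod p)[X]) =
      (X - 1) ^ m * ∏ k ∈ Finset.range m,
        (∑ i ∈ Finset.range (k + 1), X ^ i - ∑ i ∈ Finset.range (p - (k + 1)), X ^ i) := by
    conv_rhs => enter [1]; rw [← Finset.card_range m, ← Finset.prod_const]
    rw [← Finset.prod_mul_distrib]
    exact Finset.prod_congr rfl fun k _ => X_pow_sub_X_pow_eq _ _
  have hfmap : f.map (Int.castRingHom (ZMod p)) = ∑ x : ZMod p, X ^ (2 * x ^ 2).val -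
      (X - 1) ^ m * (C (ε : ZMod p) * ∏ k ∈ Finset.range m,
        (∑ i ∈ Finset.range (k + 1), X ^ i - ∑ i ∈ Finset.range (p - (k + 1)), X ^ i)) := by
    rw [mul_left_comm, ← hQ]
    simp [hf, Polynomial.map_sum, Polynomial.map_prod]
  have key := congrArg (fun q => ((eulerOp (ZMod p) ^ m) q).eval 1) (hfmap.symm.trans hg')
  simp only [map_sub, map_sum, eval_sub, eval_one_eulerOp_pow, eulerOp_pow_X_pow,
    eval_finsetSum] at key
  have hz : ((X - 1 : (ZMod p)[X]) ^ m * g).eval 1 = 0 := by simp [hm0.ne']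
  have hprod : (∏ k ∈ Finset.range m,
      (∑ i ∈ Finset.range (k + 1), X ^ i -
        ∑ i ∈ Finset.range (p - (k + 1)), X ^ i : (ZMod p)[X])).eval 1 =
      2 ^ m * m.factorial := by
    rw [eval_prod, ← Finset.prod_range_add_one_eq_factorial, Nat.cast_prod]
    conv_rhs => enter [1]; rw [← Finset.card_range m, ← Finset.prod_const]
    rw [← Finset.prod_mul_distrib]
    refine Finset.prod_congr rfl fun k hk => ?_
    have := Finset.mem_range.1 hk
    simp only [eval_sub, eval_finsetSum, eval_pow, eval_X, one_pow, Finset.sum_const,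
      Finset.card_range, nsmul_eq_mul, mul_one]
    rw [Nat.cast_sub (by omega)]
    simp
    ring
  have hsum : ∑ x : ZMod p, (C (((2 * x ^ 2).val : ZMod p) ^ m) * X ^ (2 * x ^ 2).val).eval 1 =
      -(2 ^ m : ZMod p) := by
    have h1 : ∀ x : ZMod p, (C (((2 * x ^ 2).val : ZMod p) ^ m) *
        X ^ (2 * x ^ 2).val).eval 1 = 2 ^ m * (1 - if x = 0 then 1 else 0) := by
      intro x
      simp only [ZMod.natCast_val, ZMod.cast_id', id, eval_mul, eval_C, eval_pow, eval_X,
        one_pow, mul_one]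
      rw [mul_pow, ← pow_mul]
      split_ifs with hx
      · simp [hx, hm0.ne']
      · rw [show 2 * m = p - 1 by omega, ZMod.pow_card_sub_one_eq_one hx]
        simp
    simp only [h1]
    rw [← Finset.mul_sum]
    simp [ZMod.card]
  rw [hsum, eval_mul, eval_C, hprod, hz, mul_zero] at key
  have h2 : (2 : ZMod p) ≠ 0 := by
    intro h0
    have : p ∣ 2 := (ZMod.natCast_eq_zero_iff 2 p).1 (by exact_mod_cast h0)
    have := Nat.le_of_dvd two_pos this
    omega
  have h2m : (2 : ZMod p) ^ m ≠ 0 := pow_ne_zero _ h2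
  have hfac := factorial_half_sq hm
  apply mul_left_cancel₀ h2m
  have h3 : ((-1 : ZMod p) ^ m) * (-1) ^ m = 1 := by rw [← mul_pow]; simp
  rw [pow_succ (-1 : ZMod p)] at hfac
  linear_combination (-1) ^ m * key + (-1) ^ m * ε * 2 ^ m * hfac - ε * 2 ^ m * h3

/-- The product of differences of powers of `-exp(πi/p)` in closed form. -/
theorem prod_sub_inv_eq_sin (p m : ℕ) (hm : p = 2 * m + 1) {η : ℂ}
    (hη : η = -Complex.exp (Real.pi * Complex.I / p)) (hηp : η ^ p = 1) :
    ∏ k ∈ Finset.range m, (η ^ (k + 1) - η ^ (p - (k + 1))) =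
      (∏ k ∈ Finset.range m, ((-1) ^ (k + 1) * Complex.I)) *
        ((∏ k ∈ Finset.range m, (2 * Real.sin (Real.pi * (k + 1) / p)) : ℝ) : ℂ) := by
  have hη0 : η ≠ 0 := by
    rw [hη]; exact neg_ne_zero.2 (Complex.exp_ne_zero _)
  push_cast
  rw [← Finset.prod_mul_distrib]
  refine Finset.prod_congr rfl fun k hk => ?_
  have := Finset.mem_range.1 hk
  rw [pow_sub₀ η hη0 (by omega), hηp, one_mul, ← inv_pow]
  have e1 : η ^ (k + 1) = (-1) ^ (k + 1) *
      Complex.exp ((Real.pi * (k + 1) / p : ℂ) * Complex.I) := by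
    rw [hη, neg_pow, ← Complex.exp_nat_mul]
    congr 2
    push_cast; ring
  have e2 : η⁻¹ ^ (k + 1) = (-1) ^ (k + 1) *
      Complex.exp (-(Real.pi * (k + 1) / p : ℂ) * Complex.I) := by
    rw [hη, inv_neg, ← Complex.exp_neg, neg_pow, ← Complex.exp_nat_mul]
    congr 2
    push_cast; ring
  rw [e1, e2]
  have := Complex.two_sin (Real.pi * (k + 1) / p : ℂ)
  rw [this]
  linear_combination -((-1) ^ (k + 1) * (Complex.exp (-(Real.pi * (k + 1) / p : ℂ) * Complex.I)
    - Complex.exp ((Real.pi * (k + 1) / p : ℂ) * Complex.I))) * Complex.I_sq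

theorem prod_neg_one_pow_mul_I (m : ℕ) :
    ∏ k ∈ Finset.range m, ((-1) ^ (k + 1) * Complex.I) =
      if Even m then 1 else -Complex.I := by
  induction m with
  | zero => simp
  | succ m ih =>
    rw [Finset.prod_range_succ, ih]
    by_cases h : Even m
    · have h' : ¬ Even (m + 1) := by simpa [Nat.even_add_one] using h
      rw [if_pos h, if_neg h', (Nat.not_even_iff_odd.1 h').neg_one_pow]
      simp
    · have h' : Even (m + 1) := by simpa [Nat.even_add_one] using h
      rw [if_neg h, if_pos h', h'.neg_one_pow]
      simp

theorem prod_sub_inv_sq {p m : ℕ} (hp : p.Prime) (hm : p = 2 * m + 1) {η : ℂ}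
    (hη : IsPrimitiveRoot η p) :
    (∏ k ∈ Finset.range m, (η ^ (k + 1) - η ^ (p - (k + 1)))) ^ 2 = (-1) ^ m * p := by
  have hη0 : η ≠ 0 := hη.ne_zero hp.ne_zero
  have hζ : IsPrimitiveRoot (η ^ 2) p := by
    apply hη.pow_of_coprime
    exact (Nat.coprime_primes Nat.prime_two hp).2 (by have := hp.two_le; omega)
  have hζ' : IsPrimitiveRoot (η ^ 2) (2 * m + 1) := hm ▸ hζ
  have h1 := hζ'.prod_one_sub_pow_eq_order
  have h2 : ∏ k ∈ Finset.range (2 * m), (1 - (η ^ 2) ^ (k + 1)) =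
      ∏ k ∈ Finset.range m, ((1 - (η ^ 2) ^ (k + 1)) * (1 - (η ^ 2) ^ (p - (k + 1)))) := by
    rw [two_mul, Finset.prod_range_add, Finset.prod_mul_distrib]
    congr 1
    rw [← Finset.prod_range_reflect]
    refine Finset.prod_congr rfl fun k hk => ?_
    have := Finset.mem_range.1 hk
    congr 2
    omega
  rw [h2] at h1
  have h3 : ∀ k ∈ Finset.range m, (1 - (η ^ 2) ^ (k + 1)) * (1 - (η ^ 2) ^ (p - (k + 1))) =
      -1 * (η ^ (k + 1) - η ^ (p - (k + 1))) ^ 2 := by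
    intro k hk
    have := Finset.mem_range.1 hk
    have h4 : η ^ (k + 1) * η ^ (p - (k + 1)) = 1 := by
      rw [← pow_add, show k + 1 + (p - (k + 1)) = p by omega, hη.pow_eq_one]
    rw [← pow_mul, ← pow_mul, mul_comm 2, mul_comm 2, pow_mul, pow_mul]
    linear_combination (η ^ (k + 1) * η ^ (p - (k + 1)) - 1) * h4
  rw [Finset.prod_congr rfl h3, Finset.prod_mul_distrib, Finset.prod_const, Finset.card_range,
    Finset.prod_pow] at h1
  have h5 : ((-1 : ℂ) ^ m) * (-1) ^ m = 1 := by rw [← mul_pow]; simp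
  have h6 : (p : ℂ) = (2 * m : ℕ) + 1 := by rw [hm]; push_cast; ring
  rw [h6, ← h1]
  linear_combination -(∏ k ∈ Finset.range m, (η ^ (k + 1) - η ^ (p - (k + 1)))) ^ 2 * h5

/-- The quadratic character of `F_p` with complex values. -/
noncomputable def quadCharC (p : ℕ) [Fact p.Prime] : MulChar (ZMod p) ℂ :=
  (quadraticChar (ZMod p)).ringHomComp (Int.castRingHom ℂ)

theorem quadCharC_ne_one {p : ℕ} [Fact p.Prime] (hodd : p ≠ 2) : quadCharC p ≠ 1 :=
  (MulChar.ringHomComp_ne_one_iff (RingHom.injective_int _)).2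
    (quadraticChar_ne_one (by rwa [ZMod.ringChar_zmod_n]))

theorem sum_stdAddChar_mul_sq {p : ℕ} [Fact p.Prime] (hodd : p ≠ 2) {a : ZMod p} (ha : a ≠ 0) :
    ∑ x : ZMod p, ZMod.stdAddChar (a * x ^ 2) =
      quadCharC p a * gaussSum (quadCharC p) ZMod.stdAddChar := by
  have hinv : (quadCharC p)⁻¹ = quadCharC p :=
    ((quadraticChar_isQuadratic (ZMod p)).comp _).inv
  have h1 := gaussSum_mulShift_eq (quadCharC p) (ZMod.stdAddChar (N := p)) (Units.mk0 a ha)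
  rw [hinv, Units.val_mk0] at h1
  rw [← h1, ← Finset.sum_fiberwise Finset.univ (fun x : ZMod p => x ^ 2), gaussSum]
  have h2 : ∀ t : ZMod p, ∑ x with x ^ 2 = t, (ZMod.stdAddChar (a * x ^ 2) : ℂ) =
      quadCharC p t * ZMod.stdAddChar (a * t) + ZMod.stdAddChar (a * t) := by
    intro t
    rw [Finset.sum_congr rfl (g := fun _ => (ZMod.stdAddChar (a * t) : ℂ))
      (by intro x hx; rw [(Finset.mem_filter.1 hx).2])]
    have h3 := quadraticChar_card_sqrts (F := ZMod p) (by rwa [ZMod.ringChar_zmod_n]) t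
    have h4 : (Finset.univ.filter fun x : ZMod p => x ^ 2 = t) =
        {x : ZMod p | x ^ 2 = t}.toFinset := by ext; simp
    rw [Finset.sum_const, h4, nsmul_eq_mul]
    have h5 : (({x : ZMod p | x ^ 2 = t}.toFinset.card : ℤ) : ℂ) = quadCharC p t + 1 := by
      rw [h3]; simp [quadCharC]
    rw [Int.cast_natCast] at h5
    rw [h5]; ring
  rw [Finset.sum_congr rfl fun t _ => h2 t, Finset.sum_add_distrib]
  have h6 : ∑ t : ZMod p, (ZMod.stdAddChar (a * t) : ℂ) = 0 := by
    have := AddChar.sum_eq_zero_of_ne_one (ZMod.isPrimitive_stdAddChar p ha)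
    simpa [AddChar.mulShift_apply] using this
  rw [h6, add_zero]
  simp [AddChar.mulShift_apply]

theorem gaussSum_quadCharC_sq {p m : ℕ} [Fact p.Prime] (hm : p = 2 * m + 1) (hodd : p ≠ 2) :
    gaussSum (quadCharC p) ZMod.stdAddChar ^ 2 = (-1) ^ m * p := by
  rw [gaussSum_sq (χ := quadCharC p) (quadCharC_ne_one hodd) ((quadraticChar_isQuadratic (ZMod p)).comp _)
    (ZMod.isPrimitive_stdAddChar p), ZMod.card]
  congr 1
  have h := quadraticChar_neg_one (F := ZMod p) (by rwa [ZMod.ringChar_zmod_n])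
  rw [ZMod.card, ZMod.χ₄_eq_neg_one_pow (by omega), show p / 2 = m by omega] at h
  simp [quadCharC, h]

theorem gaussSum_quadCharC_eq {p : ℕ} [Fact p.Prime] (hodd : p ≠ 2) :
    gaussSum (quadCharC p) ZMod.stdAddChar = sigmaP p * (Real.sqrt p : ℂ) := by
  have hpp : p.Prime := Fact.out
  obtain ⟨m, hm⟩ := hpp.odd_of_ne_two hodd
  have hpC : (p : ℂ) ≠ 0 := by exact_mod_cast hpp.ne_zero
  set η : ℂ := ZMod.stdAddChar (((m + 1 : ℕ) : ℤ) : ZMod p) with hη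
  have hηexp : η = -Complex.exp (Real.pi * Complex.I / p) := by
    rw [hη, ZMod.stdAddChar_coe, ← neg_one_mul, ← Complex.exp_pi_mul_I, ← Complex.exp_add]
    congr 1
    have : (p : ℂ) = 2 * m + 1 := by exact_mod_cast hm
    field_simp
    push_cast
    rw [this]; ring
  have hhalf : (2 : ZMod p) * (((m + 1 : ℕ) : ℤ) : ZMod p) = 1 := by
    have : ((2 * m + 1 : ℕ) : ZMod p) = 0 := by rw [← hm]; simp
    push_cast at this ⊢
    linear_combination this
  have hηpow : ∀ n : ℕ, η ^ n = ZMod.stdAddChar ((n : ZMod p) * (((m + 1 : ℕ) : ℤ) : ZMod p)) := by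
    intro n
    rw [hη, ← AddChar.map_nsmul_eq_pow, nsmul_eq_mul]
  have hprim : IsPrimitiveRoot η p := by
    refine ⟨by rw [hηpow]; simp, fun l hl => ?_⟩
    rw [hηpow, ← AddChar.map_zero_eq_one (ZMod.stdAddChar (N := p))] at hl
    have h0 := ZMod.injective_stdAddChar hl
    rw [← ZMod.natCast_eq_zero_iff]
    linear_combination 2 * h0 - (l : ZMod p) * hhalf
  set G := gaussSum (quadCharC p) (ZMod.stdAddChar (N := p)) with hG
  have hGsum : ∑ x : ZMod p, η ^ (2 * x ^ 2).val = G := by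
    have h1 := sum_stdAddChar_mul_sq hodd (one_ne_zero (α := ZMod p))
    rw [map_one, one_mul] at h1
    rw [hG, ← h1]
    refine Finset.sum_congr rfl fun x _ => ?_
    rw [hηpow]
    congr 1
    rw [ZMod.natCast_val, ZMod.cast_id', id]
    linear_combination x ^ 2 * hhalf
  set P := ∏ k ∈ Finset.range m, (η ^ (k + 1) - η ^ (p - (k + 1))) with hP
  have hPsq : P ^ 2 = (-1) ^ m * p := prod_sub_inv_sq hpp hm hprim
  have hGP : G = (-1) ^ m * P := by
    have hsq : G ^ 2 = P ^ 2 := by rw [hPsq, hG, gaussSum_quadCharC_sq hm hodd]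
    obtain ⟨ε, hε, hGε⟩ : ∃ ε : ℤ, (ε = 1 ∨ ε = -1) ∧ G = ε * P := by
      rcases sq_eq_sq_iff_eq_or_eq_neg.1 hsq with h | h
      · exact ⟨1, Or.inl rfl, by simp [h]⟩
      · exact ⟨-1, Or.inr rfl, by simp [h]⟩
    have hmod := gauss_sign_mod hm hprim ε (by rw [hGsum, hGε])
    have hne : (-1 : ZMod p) ≠ 1 := by
      have : Fact (2 < p) := ⟨by have := hpp.two_le; omega⟩
      exact ZMod.neg_one_ne_one
    rw [hGε]
    congr 1
    rcases hε with rfl | rfl <;> rcases Nat.even_or_odd m with he | ho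
    · simp [he.neg_one_pow]
    · rw [ho.neg_one_pow] at hmod
      exact absurd (by simpa using hmod.symm) hne
    · rw [he.neg_one_pow] at hmod
      exact absurd (by simpa using hmod) hne
    · simp [ho.neg_one_pow]
  have hPsin := prod_sub_inv_eq_sin p m hm hηexp hprim.pow_eq_one
  rw [← hP, prod_neg_one_pow_mul_I] at hPsin
  set R : ℝ := ∏ k ∈ Finset.range m, (2 * Real.sin (Real.pi * (k + 1) / p)) with hR
  have hp0 : (0 : ℝ) < p := by exact_mod_cast hpp.pos
  have hRpos : 0 < R := by
    refine Finset.prod_pos fun k hk => mul_pos two_pos (Real.sin_pos_of_pos_of_lt_pi ?_ ?_)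
    · positivity
    · rw [div_lt_iff₀ hp0]
      refine mul_lt_mul_of_pos_left ?_ Real.pi_pos
      have := Finset.mem_range.1 hk
      exact_mod_cast (by omega : k + 1 < p)
  have hRsq : R ^ 2 = p := by
    have : ((R : ℂ)) ^ 2 = p := by
      rw [hPsin, mul_pow] at hPsq
      by_cases h : Even m
      · simpa [h, h.neg_one_pow] using hPsq
      · simpa [h, (Nat.not_even_iff_odd.1 h).neg_one_pow] using hPsq
    exact_mod_cast this
  have hRsqrt : Real.sqrt p = R := by rw [← hRsq, Real.sqrt_sq hRpos.le]
  rw [hGP, hPsin, hRsqrt, sigmaP]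
  by_cases h : Even m
  · have h4 : p % 4 = 1 := by obtain ⟨t, ht⟩ := h; omega
    simp [h, h4, h.neg_one_pow]
  · have h4 : p % 4 ≠ 1 := by obtain ⟨t, ht⟩ := Nat.not_even_iff_odd.1 h; omega
    simp [h, h4, (Nat.not_even_iff_odd.1 h).neg_one_pow]

theorem ep_eq_stdAddChar (p : ℕ) [NeZero p] (t : ZMod p) : ep p t = ZMod.stdAddChar t := by
  have h := ZMod.stdAddChar_coe (N := p) (t.val : ℤ)
  rw [Int.cast_natCast, ZMod.natCast_zmod_val] at h
  rw [h, ep]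
  push_cast
  rfl

theorem chiLegendre_eq_quadCharC (p : ℕ) [Fact p.Prime] (t : ZMod p) :
    chiLegendre p t = quadCharC p t := by
  simp [chiLegendre, quadCharC, legendreSym]

theorem inner_chirp_eq (p : ℕ) [hp : Fact p.Prime] (hodd : p ≠ 2)
    (a₁ b₁ a₂ b₂ : ZMod p) (ha : a₁ ≠ a₂) :
    ∑ x : ZMod p, chirp p a₁ b₁ x * (starRingEnd ℂ) (chirp p a₂ b₂ x) =
      (sigmaP p / (Real.sqrt p : ℂ)) * chiLegendre p (a₁ - a₂) *
        ep p (-((b₁ - b₂) ^ 2 * (4 * (a₁ - a₂))⁻¹)) := by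
  have ha' : a₁ - a₂ ≠ 0 := sub_ne_zero.2 ha
  have h2 : (2 : ZMod p) ≠ 0 := by
    intro h0
    have : p ∣ 2 := (ZMod.natCast_eq_zero_iff 2 p).1 (by exact_mod_cast h0)
    exact hodd ((Nat.prime_dvd_prime_iff_eq hp.out Nat.prime_two).1 this)
  have h4 : (4 : ZMod p) ≠ 0 := by
    rw [show (4 : ZMod p) = 2 * 2 by norm_num]; exact mul_ne_zero h2 h2
  have hs0 : ((Real.sqrt p : ℝ) : ℂ) ≠ 0 :=
    Complex.ofReal_ne_zero.2 (Real.sqrt_ne_zero'.2 (Nat.cast_pos.2 hp.out.pos))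
  set c := (b₁ - b₂) * (2 * (a₁ - a₂))⁻¹ with hc
  set s := -((b₁ - b₂) ^ 2 * (4 * (a₁ - a₂))⁻¹) with hs
  have hterm : ∀ x : ZMod p, chirp p a₁ b₁ x * (starRingEnd ℂ) (chirp p a₂ b₂ x) =
      ((Real.sqrt p : ℂ)⁻¹ ^ 2 * ZMod.stdAddChar s) *
        ZMod.stdAddChar ((a₁ - a₂) * (x + c) ^ 2) := by
    intro x
    simp only [chirp, ep_eq_stdAddChar, map_mul, Complex.conj_ofReal,
      ← AddChar.map_neg_eq_conj]
    rw [mul_mul_mul_comm, ← AddChar.map_add_eq_mul, mul_assoc (_ ^ 2),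
      ← AddChar.map_add_eq_mul]
    congr 1
    · push_cast; ring
    · congr 1
      rw [hs, hc]
      field_simp
      ring
  have hshift : ∑ x : ZMod p, (ZMod.stdAddChar ((a₁ - a₂) * (x + c) ^ 2) : ℂ) =
      ∑ x : ZMod p, ZMod.stdAddChar ((a₁ - a₂) * x ^ 2) :=
    Equiv.sum_comp (Equiv.addRight c) fun y => (ZMod.stdAddChar ((a₁ - a₂) * y ^ 2) : ℂ)
  rw [Finset.sum_congr rfl fun x _ => hterm x, ← Finset.mul_sum, hshift,
    sum_stdAddChar_mul_sq hodd ha', gaussSum_quadCharC_eq hodd, ep_eq_stdAddChar,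
    chiLegendre_eq_quadCharC]
  field_simp
end

section
/- Fix integers r ≥ 1 and M ≥ 2, and let 𝒞 := {0,…,M−1}^r ⊆ ℤ^r. Let τ be the unique positive real solution of (1/M)^{2τ} + ((M−1)/M)^τ = 1. Then for all subsets A,B ⊆ 𝒞, |A+B| ≥ (|A|·|B|)^τ. -/
open scoped Pointwise

/-- The cube `𝒞 = {0,…,M−1}^r ⊆ ℤ^r`. -/
def cube (r M : ℕ) : Finset (Fin r → ℤ) :=
  Fintype.piFinset fun _ => (Finset.range M).image (Nat.cast : ℕ → ℤ)

/-- If `φ(x) = x ^ (2τ) + (1 - x) ^ τ` takes the value `1` at an interior point `c`, it is at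
least `1` to the right of `c`: its derivative has the sign of a function which is log-concave up to
a constant. -/
theorem one_le_rpow_add_one_sub_rpow {τ c x : ℝ} (hτ : 1 / 2 ≤ τ) (hτ1 : τ ≤ 1) (hc0 : 0 < c)
    (hc : c ^ (2 * τ) + (1 - c) ^ τ = 1) (hcx : c ≤ x) (hx1 : x ≤ 1) :
    1 ≤ x ^ (2 * τ) + (1 - x) ^ τ := by
  by_contra! hlt
  have hτ0 : 0 < τ := by linarith
  have hcx' : c < x := lt_of_le_of_ne hcx fun h => by subst h; linarith
  have hx1' : x < 1 := lt_of_le_of_ne hx1 fun h => by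
    subst h
    simp [Real.zero_rpow hτ0.ne'] at hlt
  set φ : ℝ → ℝ := fun y => y ^ (2 * τ) + (1 - y) ^ τ with hφ
  set φ' : ℝ → ℝ := fun y => 2 * τ * y ^ (2 * τ - 1) - τ * (1 - y) ^ (τ - 1) with hφ'
  have hcont : Continuous φ := by
    refine Continuous.add ?_ ?_
    · exact Real.continuous_rpow_const (by linarith)
    · exact (Real.continuous_rpow_const hτ0.le).comp (by fun_prop)
  have hderiv : ∀ y ∈ Set.Ioo (0 : ℝ) 1, HasDerivAt φ (φ' y) y := by
    intro y hy
    have h1 := Real.hasDerivAt_rpow_const (x := y) (p := 2 * τ) (Or.inl hy.1.ne')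
    have h2 := ((hasDerivAt_id y).const_sub 1).rpow_const (p := τ)
      (Or.inl (sub_pos.2 hy.2).ne')
    refine (h1.add h2).congr_deriv ?_
    simp only [hφ', id]
    ring
  set L : ℝ → ℝ := fun y => (2 * τ - 1) * Real.log y + (1 - τ) * Real.log (1 - y) with hL
  have hconc : ConcaveOn ℝ (Set.Ioo (0 : ℝ) 1) L := by
    have hlog := strictConcaveOn_log_Ioi.concaveOn
    refine ConcaveOn.add (ConcaveOn.smul (by linarith) ?_) (ConcaveOn.smul (by linarith) ?_)
    · exact hlog.subset Set.Ioo_subset_Ioi_self (convex_Ioo 0 1)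
    · refine ⟨convex_Ioo 0 1, fun u hu v hv s t hs ht hst => ?_⟩
      have h := hlog.2 (Set.mem_Ioi.2 (sub_pos.2 hu.2)) (Set.mem_Ioi.2 (sub_pos.2 hv.2)) hs ht hst
      have e : s • (1 - u) + t • (1 - v) = 1 - (s • u + t • v) := by
        simp only [smul_eq_mul]
        linear_combination hst
      rwa [e] at h
  have hexp : ∀ y ∈ Set.Ioo (0 : ℝ) 1,
      φ' y = τ * (1 - y) ^ (τ - 1) * (2 * Real.exp (L y) - 1) := by
    intro y hy
    have hy1 : 0 < 1 - y := sub_pos.2 hy.2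
    have e : Real.exp (L y) = y ^ (2 * τ - 1) * (1 - y) ^ (1 - τ) := by
      rw [Real.rpow_def_of_pos hy.1, Real.rpow_def_of_pos hy1, ← Real.exp_add]
      congr 1
      simp only [hL]
      ring
    have e' : (1 - y) ^ (τ - 1) * (1 - y) ^ (1 - τ) = 1 := by
      rw [← Real.rpow_add hy1]
      simp
    rw [e]
    simp only [hφ']
    linear_combination (-2 * τ * y ^ (2 * τ - 1)) * e'
  have hpos : ∀ y ∈ Set.Ioo (0 : ℝ) 1, 0 < τ * (1 - y) ^ (τ - 1) := fun y hy =>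
    mul_pos hτ0 (Real.rpow_pos_of_pos (sub_pos.2 hy.2) _)
  have hφ0 : φ 0 = 1 := by
    simp [hφ, Real.zero_rpow (by linarith : 2 * τ ≠ 0)]
  have hφ1 : φ 1 = 1 := by
    simp [hφ, Real.zero_rpow hτ0.ne']
  have hmvt : ∀ u v : ℝ, 0 ≤ u → u < v → v ≤ 1 → ∃ w ∈ Set.Ioo u v,
      τ * (1 - w) ^ (τ - 1) * (2 * Real.exp (L w) - 1) * (v - u) = φ v - φ u ∧
        w ∈ Set.Ioo (0 : ℝ) 1 := by
    intro u v hu huv hv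
    obtain ⟨w, hw, h⟩ := exists_hasDerivAt_eq_slope φ φ' huv hcont.continuousOn
      fun y hy => hderiv y ⟨hu.trans_lt hy.1, hy.2.trans_le hv⟩
    have hw' : w ∈ Set.Ioo (0 : ℝ) 1 := ⟨hu.trans_lt hw.1, hw.2.trans_le hv⟩
    refine ⟨w, hw, ?_, hw'⟩
    rw [← hexp w hw', h]
    field_simp [(sub_pos.2 huv).ne']
  obtain ⟨w₁, hw₁, e₁, m₁⟩ := hmvt 0 c le_rfl hc0 (by linarith)
  obtain ⟨w₂, hw₂, e₂, m₂⟩ := hmvt c x hc0.le hcx' hx1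
  obtain ⟨w₃, hw₃, e₃, m₃⟩ := hmvt x 1 (by linarith) hx1' le_rfl
  have hφc : φ c = 1 := hc
  have hφx : φ x < 1 := hlt
  have h₁ : 1 ≤ 2 * Real.exp (L w₁) := by
    by_contra! h
    have := mul_pos (mul_pos (hpos w₁ m₁) (sub_pos.2 h)) hc0
    linarith
  have h₂ : 2 * Real.exp (L w₂) < 1 := by
    by_contra! h
    have := mul_nonneg (mul_nonneg (hpos w₂ m₂).le (sub_nonneg.2 h)) (sub_pos.2 hcx').le
    linarith
  have h₃ : 1 ≤ 2 * Real.exp (L w₃) := by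
    by_contra! h
    have := mul_pos (mul_pos (hpos w₃ m₃) (sub_pos.2 h)) (sub_pos.2 hx1')
    linarith
  have hmin := hconc.min_le_of_mem_Icc m₁ m₃
    (⟨(hw₁.2.trans hw₂.1).le, (hw₂.2.trans hw₃.1).le⟩ : w₂ ∈ Set.Icc w₁ w₃)
  rcases min_le_iff.1 hmin with h | h
  · linarith [Real.exp_le_exp.2 h]
  · linarith [Real.exp_le_exp.2 h]

/-- The solution `τ` of `(1 / M) ^ (2τ) + ((M - 1) / M) ^ τ = 1` lies in `[1 / 2, 1]`. -/
theorem exponent_mem_Icc {M : ℕ} (hM : 2 ≤ M) {τ : ℝ}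
    (hτeq : (1 / (M : ℝ)) ^ (2 * τ) + (((M : ℝ) - 1) / (M : ℝ)) ^ τ = 1) :
    τ ∈ Set.Icc (1 / 2 : ℝ) 1 := by
  have hM' : (2 : ℝ) ≤ M := by exact_mod_cast hM
  have hc0 : 0 < 1 / (M : ℝ) := by positivity
  have hc1 : 1 / (M : ℝ) < 1 := by
    rw [div_lt_one (by linarith)]
    linarith
  have e : ((M : ℝ) - 1) / M = 1 - 1 / M := by field_simp
  rw [e] at hτeq
  generalize 1 / (M : ℝ) = c at *
  have hd0 : 0 < 1 - c := by linarith
  constructor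
  · by_contra! h
    have h1 := Real.rpow_lt_rpow_of_exponent_gt hc0 hc1 (by linarith : 2 * τ < 1)
    have h2 := Real.rpow_lt_rpow_of_exponent_gt hd0 (by linarith) (by linarith : τ < 1)
    rw [Real.rpow_one] at h1 h2
    linarith
  · by_contra! h
    have h1 := Real.rpow_lt_rpow_of_exponent_gt hc0 hc1 (by linarith : 1 < 2 * τ)
    have h2 := Real.rpow_lt_rpow_of_exponent_gt hd0 (by linarith) h
    rw [Real.rpow_one] at h1 h2
    linarith

theorem mul_rpow_le_rpow_add_rpow {τ m S T a b : ℝ} (hτ : 0 ≤ τ)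
    (hφ : ∀ x, 1 / m ≤ x → x ≤ 1 → 1 ≤ x ^ (2 * τ) + (1 - x) ^ τ) (hm : 0 < m)
    (hS : 0 < S) (hT : 0 < T) (haS : a ≤ S) (hSa : S ≤ m * a) (hab : a * T ≤ b * S) :
    (S * T) ^ τ ≤ (a * b) ^ τ + ((S - a) * T) ^ τ := by
  have ha : 0 ≤ a := by
    by_contra! h
    nlinarith
  have hp1 : a / S ≤ 1 := (div_le_one hS).2 haS
  have hp : 1 / m ≤ a / S := by
    rw [div_le_div_iff₀ hm hS]
    linarith
  have hp0 : 0 ≤ a / S := by positivity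
  have e : (S - a) * T = (S * T) * (1 - a / S) := by field_simp
  have h1 : (S * T) * (a / S) ^ 2 ≤ a * b := by
    have : (S * T) * (a / S) ^ 2 = a * (a * T / S) := by field_simp
    rw [this]
    exact mul_le_mul_of_nonneg_left ((div_le_iff₀ hS).2 hab) ha
  have h2 := Real.rpow_le_rpow (by positivity) h1 hτ
  rw [Real.mul_rpow (by positivity) (by positivity), ← Real.rpow_natCast, ← Real.rpow_mul hp0] at h2
  rw [e, Real.mul_rpow (by positivity : 0 ≤ S * T) (by linarith)]
  have h3 := mul_le_mul_of_nonneg_left (hφ _ hp hp1) (Real.rpow_nonneg (by positivity : 0 ≤ S * T) τ)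
  push_cast at h2
  linarith

section

variable {G : Type*} [AddCommGroup G] [LinearOrder G] [IsOrderedAddMonoid G]

/-- Greedy step: `U` and `V` are the points of `A` and `B` still to be used (those with the smallest
weights), and `K` is the set of sums already used. -/
theorem rpow_sum_mul_sum_le_sum_sdiff {τ : ℝ} (hτ : 0 < τ) {M : ℕ} (hM : 0 < M)
    (hφ : ∀ x, 1 / (M : ℝ) ≤ x → x ≤ 1 → 1 ≤ x ^ (2 * τ) + (1 - x) ^ τ)
    {A B : Finset G} (hA : A.card ≤ M) (hB : B.card ≤ M) {f g h : G → ℝ}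
    (hf : ∀ a, 0 ≤ f a) (hg : ∀ b, 0 ≤ g b) (hh : ∀ c, 0 ≤ h c)
    (hfgh : ∀ a ∈ A, ∀ b ∈ B, (f a * g b) ^ τ ≤ h (a + b)) (n : ℕ) :
    ∀ U ⊆ A, ∀ V ⊆ B, ∀ K : Finset G, U.card + V.card = n →
      (∀ a ∈ A \ U, ∀ u ∈ U, f u ≤ f a) → (∀ b ∈ B \ V, ∀ v ∈ V, g v ≤ g b) →
      K.card ≤ (A \ U).card + (B \ V).card →
      ((∑ a ∈ U, f a) * ∑ b ∈ V, g b) ^ τ ≤ ∑ c ∈ (A + B) \ K, h c := by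
  induction n with
  | zero =>
    intro U _ V _ K hn _ _ _
    have hU : U = ∅ := Finset.card_eq_zero.1 (by omega)
    simpa [hU, Real.zero_rpow hτ.ne'] using Finset.sum_nonneg fun c _ => hh c
  | succ n ih =>
    intro U hUA V hVB K hn hfU hgV hK
    have hS0 : 0 ≤ ∑ a ∈ U, f a := Finset.sum_nonneg fun a _ => hf a
    have hT0 : 0 ≤ ∑ b ∈ V, g b := Finset.sum_nonneg fun b _ => hg b
    rcases hS0.eq_or_lt with hS | hS
    · simpa [← hS, Real.zero_rpow hτ.ne'] using Finset.sum_nonneg fun c _ => hh c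
    rcases hT0.eq_or_lt with hT | hT
    · simpa [← hT, Real.zero_rpow hτ.ne'] using Finset.sum_nonneg fun c _ => hh c
    have hUne : U.Nonempty := Finset.nonempty_of_sum_ne_zero hS.ne'
    have hVne : V.Nonempty := Finset.nonempty_of_sum_ne_zero hT.ne'
    obtain ⟨a, haU, ha⟩ := U.exists_max_image f hUne
    obtain ⟨b, hbV, hb⟩ := V.exists_max_image g hVne
    have haA : a ∉ A \ U := by simp [haU]
    have hbB : b ∉ B \ V := by simp [hbV]
    have hcard := cauchy_davenport_add_of_linearOrder_isCancelAdd
      (Finset.insert_nonempty a (A \ U)) (Finset.insert_nonempty b (B \ V))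
    rw [Finset.card_insert_of_notMem haA, Finset.card_insert_of_notMem hbB] at hcard
    obtain ⟨k, hk, hkK⟩ := Finset.exists_mem_notMem_of_card_lt_card
      (s := K) (t := insert a (A \ U) + insert b (B \ V)) (by omega)
    obtain ⟨a', ha', b', hb', rfl⟩ := Finset.mem_add.1 hk
    have haa' : a' ∈ A ∧ f a ≤ f a' := by
      rcases Finset.mem_insert.1 ha' with rfl | h'
      · exact ⟨hUA haU, le_rfl⟩
      · exact ⟨(Finset.mem_sdiff.1 h').1, hfU _ h' _ haU⟩
    have hbb' : b' ∈ B ∧ g b ≤ g b' := by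
      rcases Finset.mem_insert.1 hb' with rfl | h'
      · exact ⟨hVB hbV, le_rfl⟩
      · exact ⟨(Finset.mem_sdiff.1 h').1, hgV _ h' _ hbV⟩
    have hhk : (f a * g b) ^ τ ≤ h (a' + b') :=
      (Real.rpow_le_rpow (mul_nonneg (hf a) (hg b))
        (mul_le_mul haa'.2 hbb'.2 (hg b) (hf a')) hτ.le).trans (hfgh _ haa'.1 _ hbb'.1)
    have hsum : ∑ c ∈ (A + B) \ K, h c =
        h (a' + b') + ∑ c ∈ (A + B) \ insert (a' + b') K, h c := by
      rw [← Finset.add_sum_erase _ _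
        (Finset.mem_sdiff.2 ⟨Finset.add_mem_add haa'.1 hbb'.1, hkK⟩), Finset.sdiff_insert]
    have hKins : (insert (a' + b') K).card ≤ (A \ U).card + (B \ V).card + 1 :=
      (Finset.card_insert_le _ _).trans (by omega)
    have hMpos : (0 : ℝ) < M := by exact_mod_cast hM
    have hSM : ∑ u ∈ U, f u ≤ M * f a := by
      refine (Finset.sum_le_card_nsmul U f (f a) ha).trans ?_
      rw [nsmul_eq_mul]
      exact mul_le_mul_of_nonneg_right
        (by exact_mod_cast (Finset.card_le_card hUA).trans hA) (hf a)
    have hTM : ∑ v ∈ V, g v ≤ M * g b := by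
      refine (Finset.sum_le_card_nsmul V g (g b) hb).trans ?_
      rw [nsmul_eq_mul]
      exact mul_le_mul_of_nonneg_right
        (by exact_mod_cast (Finset.card_le_card hVB).trans hB) (hg b)
    have haS : f a ≤ ∑ u ∈ U, f u := Finset.single_le_sum (fun u _ => hf u) haU
    have hbT : g b ≤ ∑ v ∈ V, g v := Finset.single_le_sum (fun v _ => hg v) hbV
    rw [hsum]
    rcases le_total (f a * ∑ v ∈ V, g v) (g b * ∑ u ∈ U, f u) with hab | hab
    · have key := mul_rpow_le_rpow_add_rpow hτ.le hφ hMpos hS hT haS hSM hab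
      have hins : A \ U.erase a = insert a (A \ U) := Finset.sdiff_erase (hUA haU)
      have hrec := ih (U.erase a) ((Finset.erase_subset _ _).trans hUA) V hVB
        (insert (a' + b') K) (by have := Finset.card_erase_add_one haU; omega)
        (by
          intro x hx u hu
          rw [hins] at hx
          rcases Finset.mem_insert.1 hx with rfl | hx
          · exact ha u (Finset.mem_of_mem_erase hu)
          · exact hfU x hx u (Finset.mem_of_mem_erase hu))
        hgV (by rw [hins, Finset.card_insert_of_notMem haA]; omega)
      rw [Finset.sum_erase_eq_sub haU] at hrec
      linarith
    · have key := mul_rpow_le_rpow_add_rpow hτ.le hφ hMpos hT hS hbT hTM hab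
      have hins : B \ V.erase b = insert b (B \ V) := Finset.sdiff_erase (hVB hbV)
      have hrec := ih U hUA (V.erase b) ((Finset.erase_subset _ _).trans hVB)
        (insert (a' + b') K) (by have := Finset.card_erase_add_one hbV; omega) hfU
        (by
          intro x hx v hv
          rw [hins] at hx
          rcases Finset.mem_insert.1 hx with rfl | hx
          · exact hb v (Finset.mem_of_mem_erase hv)
          · exact hgV x hx v (Finset.mem_of_mem_erase hv))
        (by rw [hins, Finset.card_insert_of_notMem hbB]; omega)
      rw [Finset.sum_erase_eq_sub hbV, mul_comm] at hrec
      rw [mul_comm (f a)] at hhk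
      rw [mul_comm (∑ a ∈ U, f a)]
      linarith

/-- A Prékopa–Leindler type inequality for weights supported on at most `M` points. -/
theorem rpow_sum_mul_sum_le_sum_add {τ : ℝ} (hτ : 0 < τ) {M : ℕ} (hM : 0 < M)
    (hφ : ∀ x, 1 / (M : ℝ) ≤ x → x ≤ 1 → 1 ≤ x ^ (2 * τ) + (1 - x) ^ τ)
    {A B : Finset G} (hA : A.card ≤ M) (hB : B.card ≤ M) {f g h : G → ℝ}
    (hf : ∀ a, 0 ≤ f a) (hg : ∀ b, 0 ≤ g b) (hh : ∀ c, 0 ≤ h c)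
    (hfgh : ∀ a ∈ A, ∀ b ∈ B, (f a * g b) ^ τ ≤ h (a + b)) :
    ((∑ a ∈ A, f a) * ∑ b ∈ B, g b) ^ τ ≤ ∑ c ∈ A + B, h c := by
  simpa using rpow_sum_mul_sum_le_sum_sdiff hτ hM hφ hA hB hf hg hh hfgh _ A subset_rfl B subset_rfl
    ∅ rfl (by simp) (by simp) (by simp)

end

/-- The slice of `A` over first coordinate `i`. -/
def slice {r : ℕ} (A : Finset (Fin (r + 1) → ℤ)) (i : ℤ) : Finset (Fin r → ℤ) :=
  {v ∈ A | v 0 = i}.image Fin.tail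

theorem mem_slice {r : ℕ} {A : Finset (Fin (r + 1) → ℤ)} {i : ℤ} {v : Fin r → ℤ} :
    v ∈ slice A i ↔ (Fin.cons i v : Fin (r + 1) → ℤ) ∈ A := by
  simp only [slice, Finset.mem_image, Finset.mem_filter]
  constructor
  · rintro ⟨w, ⟨hw, rfl⟩, rfl⟩
    rwa [Fin.cons_self_tail]
  · exact fun hv => ⟨_, ⟨hv, Fin.cons_zero _ _⟩, Fin.tail_cons _ _⟩

theorem card_slice {r : ℕ} (A : Finset (Fin (r + 1) → ℤ)) (i : ℤ) :
    (slice A i).card = {v ∈ A | v 0 = i}.card := by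
  refine Finset.card_image_of_injOn fun v hv w hw hvw => ?_
  have hv' := (Finset.mem_filter.1 hv).2
  have hw' := (Finset.mem_filter.1 hw).2
  rw [← Fin.cons_self_tail v, ← Fin.cons_self_tail w, hv', hw', hvw]

theorem card_eq_sum_card_slice {r : ℕ} {A : Finset (Fin (r + 1) → ℤ)} {I : Finset ℤ}
    (hA : ∀ v ∈ A, v 0 ∈ I) : A.card = ∑ i ∈ I, (slice A i).card := by
  simp only [card_slice]
  exact Finset.card_eq_sum_card_fiberwise hA

theorem slice_add_slice_subset {r : ℕ} (A B : Finset (Fin (r + 1) → ℤ)) (i j : ℤ) :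
    slice A i + slice B j ⊆ slice (A + B) (i + j) := by
  intro v hv
  obtain ⟨a, ha, b, hb, rfl⟩ := Finset.mem_add.1 hv
  rw [mem_slice] at ha hb ⊢
  convert Finset.add_mem_add ha hb using 1
  ext k
  refine Fin.cases ?_ (fun k => ?_) k <;> simp

theorem slice_subset_cube {r M : ℕ} {A : Finset (Fin (r + 1) → ℤ)} (hA : A ⊆ cube (r + 1) M)
    (i : ℤ) : slice A i ⊆ cube r M := by
  intro v hv
  have h := Fintype.mem_piFinset.1 (hA (mem_slice.1 hv))
  exact Fintype.mem_piFinset.2 fun k => by simpa using h k.succ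

theorem card_sumset_cube_ge (r M : ℕ) (hr : 1 ≤ r) (hM : 2 ≤ M) (τ : ℝ) (hτ : 0 < τ)
    (hτeq : (1 / (M : ℝ)) ^ (2 * τ) + (((M : ℝ) - 1) / (M : ℝ)) ^ τ = 1)
    (A B : Finset (Fin r → ℤ)) (hA : A ⊆ cube r M) (hB : B ⊆ cube r M) :
    ((A.card : ℝ) * (B.card : ℝ)) ^ τ ≤ ((A + B).card : ℝ) := by
  have hM0 : 0 < M := by omega
  have hMpos : (0 : ℝ) < M := by exact_mod_cast hM0
  have hmem := exponent_mem_Icc hM hτeq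
  have hφ : ∀ x, 1 / (M : ℝ) ≤ x → x ≤ 1 → 1 ≤ x ^ (2 * τ) + (1 - x) ^ τ := fun x =>
    one_le_rpow_add_one_sub_rpow hmem.1 hmem.2 (by positivity)
      (by rwa [one_sub_div hMpos.ne'])
  clear hr
  induction r with
  | zero =>
    rcases A.eq_empty_or_nonempty with rfl | hAne
    · simp [Real.zero_rpow hτ.ne']
    rcases B.eq_empty_or_nonempty with rfl | hBne
    · simp [Real.zero_rpow hτ.ne']
    have h1 : (1 : ℝ) ≤ (A + B).card := by exact_mod_cast (hAne.add hBne).card_pos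
    have hA1 : (A.card : ℝ) ≤ 1 := by exact_mod_cast Finset.card_le_one_of_subsingleton A
    have hB1 : (B.card : ℝ) ≤ 1 := by exact_mod_cast Finset.card_le_one_of_subsingleton B
    exact (Real.rpow_le_one (by positivity) (mul_le_one₀ hA1 (by positivity) hB1) hτ.le).trans h1
  | succ r ih =>
    set I : Finset ℤ := (Finset.range M).image (Nat.cast : ℕ → ℤ) with hI
    have hIcard : I.card ≤ M := Finset.card_image_le.trans (Finset.card_range M).le
    have hAI : ∀ v ∈ A, v 0 ∈ I := fun v hv => Fintype.mem_piFinset.1 (hA hv) 0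
    have hBI : ∀ v ∈ B, v 0 ∈ I := fun v hv => Fintype.mem_piFinset.1 (hB hv) 0
    have hABI : ∀ v ∈ A + B, v 0 ∈ I + I := by
      intro v hv
      obtain ⟨a, ha, b, hb, rfl⟩ := Finset.mem_add.1 hv
      exact Finset.add_mem_add (hAI a ha) (hBI b hb)
    rw [card_eq_sum_card_slice hAI, card_eq_sum_card_slice hBI, card_eq_sum_card_slice hABI]
    push_cast
    refine rpow_sum_mul_sum_le_sum_add hτ hM0 hφ hIcard hIcard (fun _ => by positivity)
      (fun _ => by positivity) (fun _ => by positivity) fun i _ j _ => ?_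
    refine (ih _ _ (slice_subset_cube hA i) (slice_subset_cube hB j)).trans ?_
    exact_mod_cast Finset.card_le_card (slice_add_slice_subset A B i j)
end

section
/- Fix integers r ≥ 1 and M ≥ 2, let τ be the unique positive real solution of (1/M)^{2τ} + ((M−1)/M)^τ = 1, let p be a prime with (2M)^r ≤ p, and let 𝓑 := {Σ_{j=1}^r x_j(2M)^{j−1} : x_1,…,x_r ∈ {0,…,M−1}} regarded as a subset of F_p via reduction mod p. Let s,t > 0 be real numbers with (2τ−1)s ≥ t. Then every subset B ⊆ 𝓑 with |B| > p^s satisfies |B−B| > p^t·|B|. -/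
open scoped Pointwise BigOperators

/-- The set `𝓑 = {∑_{j=1}^r x_j(2M)^{j−1} : x_j ∈ {0,…,M−1}} ⊆ F_p`. -/
def Bset (M r p : ℕ) : Finset (ZMod p) :=
  (Fintype.piFinset fun _ : Fin r => Finset.range M).image
    fun x => ((∑ j : Fin r, x j * (2 * M) ^ (j : ℕ) : ℕ) : ZMod p)

lemma rpow_convex_combo_le_of_nonpos {q y z a b : ℝ} (hq : q ≤ 0) (hy : 0 < y) (hz : 0 < z)
    (ha : 0 ≤ a) (hb : 0 ≤ b) (hab : a + b = 1) :
    (a * y + b * z) ^ q ≤ a * y ^ q + b * z ^ q := by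
  have h := Real.geom_mean_le_arith_mean2_weighted ha hb hy.le hz.le hab
  calc (a * y + b * z) ^ q ≤ (y ^ a * z ^ b) ^ q :=
        Real.rpow_le_rpow_of_nonpos (by positivity) h hq
    _ = (y ^ q) ^ a * (z ^ q) ^ b := by
        rw [Real.mul_rpow (by positivity) (by positivity), ← Real.rpow_mul hy.le,
          ← Real.rpow_mul hz.le, ← Real.rpow_mul hy.le, ← Real.rpow_mul hz.le, mul_comm a,
          mul_comm b]
    _ ≤ _ := Real.geom_mean_le_arith_mean2_weighted ha hb (by positivity) (by positivity) hab

/-- If `x ↦ x ^ (2τ) + (1 - x) ^ τ` takes the value `1` at an interior point `c`, then it is at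
least `1` on `[c, 1]`. -/
lemma one_le_rpow_add_rpow {τ c x : ℝ} (hτ : 1 / 2 ≤ τ) (hτ1 : τ ≤ 1) (hc : 0 < c)
    (hceq : c ^ (2 * τ) + (1 - c) ^ τ = 1) (hcx : c ≤ x) (hx1 : x ≤ 1) :
    1 ≤ x ^ (2 * τ) + (1 - x) ^ τ := by
  by_contra! hlt
  set φ : ℝ → ℝ := fun x => x ^ (2 * τ) + (1 - x) ^ τ with hφ
  set ψ : ℝ → ℝ := fun x => 2 * τ * x ^ (2 * τ - 1) - τ * (1 - x) ^ (τ - 1) with hψ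
  have hφ0 : φ 0 = 1 := by
    change (0 : ℝ) ^ (2 * τ) + (1 - 0) ^ τ = 1
    rw [Real.zero_rpow (show 2 * τ ≠ 0 by linarith), sub_zero, Real.one_rpow, zero_add]
  have hφ1 : φ 1 = 1 := by
    change (1 : ℝ) ^ (2 * τ) + (1 - 1) ^ τ = 1
    rw [sub_self, Real.zero_rpow (show τ ≠ 0 by linarith), Real.one_rpow, add_zero]
  have hφc : φ c = 1 := hceq
  have hφx : φ x < 1 := hlt
  have hcx' : c < x := lt_of_le_of_ne hcx (by rintro rfl; linarith)
  have hx1' : x < 1 := lt_of_le_of_ne hx1 (by rintro rfl; linarith)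
  have hcont : Continuous φ := by
    refine .add (continuous_id.rpow_const fun _ => Or.inr (by linarith))
      ((continuous_const.sub continuous_id).rpow_const fun _ => Or.inr (by linarith))
  have hder : ∀ y, 0 < y → y < 1 → HasDerivAt φ (ψ y) y := by
    intro y hy hy1
    have h1 := Real.hasDerivAt_rpow_const (x := y) (p := 2 * τ) (Or.inl hy.ne')
    have h2 := ((hasDerivAt_id y).const_sub 1).rpow_const (p := τ)
      (Or.inl (by simp only [id]; linarith))
    refine (h1.add h2).congr_deriv ?_
    simp only [hψ, id]; ring
  obtain ⟨u, hu, hu'⟩ := exists_hasDerivAt_eq_slope φ ψ hc hcont.continuousOn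
    fun y hy => hder y hy.1 (by linarith [hy.2])
  obtain ⟨v, hv, hv'⟩ := exists_hasDerivAt_eq_slope φ ψ hcx' hcont.continuousOn
    fun y hy => hder y (by linarith [hy.1]) (by linarith [hy.2])
  obtain ⟨w, hw, hw'⟩ := exists_hasDerivAt_eq_slope φ ψ hx1' hcont.continuousOn
    fun y hy => hder y (by linarith [hy.1]) hy.2
  have hu0 : ψ u = 0 := by rw [hu', hφc, hφ0]; simp
  have hv0 : ψ v < 0 := by
    rw [hv', hφc]; exact div_neg_of_neg_of_pos (by linarith) (by linarith)
  have hw0 : 0 < ψ w := by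
    rw [hw', hφ1]; exact div_pos (by linarith) (by linarith)
  obtain ⟨hu1, hu2⟩ := hu
  obtain ⟨hv1, hv2⟩ := hv
  obtain ⟨hw1, hw2⟩ := hw
  obtain ⟨a, b, ha, hb, hab, hv3⟩ : v ∈ segment ℝ u w := by
    rw [segment_eq_Icc (by linarith)]; constructor <;> linarith
  simp only [smul_eq_mul] at hv3
  have h1 : a * u ^ (2 * τ - 1) + b * w ^ (2 * τ - 1) ≤ v ^ (2 * τ - 1) := by
    have := (Real.concaveOn_rpow (p := 2 * τ - 1) (by linarith) (by linarith)).2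
      (show u ∈ Set.Ici 0 by simp; linarith) (show w ∈ Set.Ici 0 by simp; linarith) ha hb hab
    simpa only [smul_eq_mul, hv3] using this
  have h2 : (1 - v) ^ (τ - 1) ≤ a * (1 - u) ^ (τ - 1) + b * (1 - w) ^ (τ - 1) := by
    have := rpow_convex_combo_le_of_nonpos (q := τ - 1) (by linarith)
      (show 0 < 1 - u by linarith) (show 0 < 1 - w by linarith) ha hb hab
    rwa [show a * (1 - u) + b * (1 - w) = 1 - v by rw [← hv3]; linear_combination hab] at this
  have h3 : a * ψ u + b * ψ w ≤ ψ v := by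
    simp only [hψ]
    nlinarith
  have : 0 ≤ b * ψ w := by positivity
  rw [hu0] at h3
  linarith

lemma lt_one_of_rpow_add_rpow_eq_one {τ c : ℝ} (hc : 0 < c) (hc1 : c < 1)
    (hceq : c ^ (2 * τ) + (1 - c) ^ τ = 1) : τ < 1 := by
  by_contra! h
  have h1 : c ^ (2 * τ) ≤ c ^ (2 : ℝ) :=
    Real.rpow_le_rpow_of_exponent_ge hc hc1.le (by linarith)
  have h2 : (1 - c) ^ τ ≤ (1 - c) ^ (1 : ℝ) :=
    Real.rpow_le_rpow_of_exponent_ge (by linarith) (by linarith) h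
  rw [Real.rpow_one] at h2
  rw [Real.rpow_two] at h1
  nlinarith

lemma mul_rpow_le_add_of_div_le_div {τ c a F b G : ℝ} (hτ : 1 / 2 ≤ τ) (hτ1 : τ ≤ 1) (hc : 0 < c)
    (hceq : c ^ (2 * τ) + (1 - c) ^ τ = 1) (hF : 0 < F) (hG : 0 < G) (ha : c * F ≤ a)
    (haF : a ≤ F) (hab : a / F ≤ b / G) :
    (F * G) ^ τ ≤ (a * b) ^ τ + ((F - a) * G) ^ τ := by
  have hx : c ≤ a / F := by rwa [le_div_iff₀ hF]
  have hx1 : a / F ≤ 1 := by rwa [div_le_one hF]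
  have hx0 : 0 < a / F := hc.trans_le hx
  have key := one_le_rpow_add_rpow hτ hτ1 hc hceq hx hx1
  have h1 : (a / F) ^ (2 * τ) ≤ (a / F * (b / G)) ^ τ := by
    rw [Real.rpow_mul hx0.le, Real.rpow_two, sq]
    gcongr
  calc (F * G) ^ τ ≤ ((a / F * (b / G)) ^ τ + (1 - a / F) ^ τ) * (F * G) ^ τ :=
        le_mul_of_one_le_left (by positivity) (by linarith)
    _ = (a * b) ^ τ + ((F - a) * G) ^ τ := by
        rw [add_mul, ← Real.mul_rpow (by have := hx0.le.trans hab; positivity) (by positivity),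
          ← Real.mul_rpow (by linarith) (by positivity)]
        congr 2 <;> field_simp

lemma card_add_card_sub_one_le_card_sub {s t : Finset ℤ} (hs : s.Nonempty) (ht : t.Nonempty) :
    s.card + t.card - 1 ≤ (s - t).card := by
  have := cauchy_davenport_add_of_linearOrder_isCancelAdd hs ht.neg
  rwa [Finset.card_neg, ← sub_eq_add_neg] at this

/-- A max-convolution inequality on `ℤ`, where `A` and `B` collect points with largest values of `f`
and `g` that are already accounted for by the differences in `U`. -/
lemma rpow_sum_mul_sum_le_sum_sdiff_s13 {τ : ℝ} {M : ℕ} (hM : 0 < M) (hτ : 1 / 2 ≤ τ) (hτ1 : τ ≤ 1)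
    (hτeq : (1 / (M : ℝ)) ^ (2 * τ) + (1 - 1 / (M : ℝ)) ^ τ = 1)
    {S T : Finset ℤ} (hS : S.card ≤ M) (hT : T.card ≤ M) {f g h : ℤ → ℝ}
    (hf : ∀ i ∈ S, 0 ≤ f i) (hg : ∀ j ∈ T, 0 ≤ g j) (hh : ∀ k, 0 ≤ h k)
    (hfg : ∀ i ∈ S, ∀ j ∈ T, (f i * g j) ^ τ ≤ h (i - j)) (n : ℕ) :
    ∀ {A B U : Finset ℤ}, A ⊆ S → B ⊆ T → U.card = A.card + B.card →
      (S \ A).card + (T \ B).card = n →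
      (∀ i ∈ A, ∀ i' ∈ S \ A, f i' ≤ f i) → (∀ j ∈ B, ∀ j' ∈ T \ B, g j' ≤ g j) →
      ((∑ i ∈ S \ A, f i) * ∑ j ∈ T \ B, g j) ^ τ ≤ ∑ k ∈ (S - T) \ U, h k := by
  classical
  induction n with
  | zero =>
    intro A B U _ _ _ hn _ _
    have h1 : S \ A = ∅ := by rw [← Finset.card_eq_zero]; omega
    rw [h1]
    simp only [Finset.sum_empty, zero_mul]
    rw [Real.zero_rpow (by linarith)]
    exact Finset.sum_nonneg fun k _ => hh k
  | succ n ih =>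
    intro A B U hA hB hU hn hAf hBg
    have hF0 : 0 ≤ ∑ i ∈ S \ A, f i :=
      Finset.sum_nonneg fun i hi => hf i (Finset.mem_sdiff.1 hi).1
    have hG0 : 0 ≤ ∑ j ∈ T \ B, g j :=
      Finset.sum_nonneg fun i hi => hg i (Finset.mem_sdiff.1 hi).1
    have hR0 : 0 ≤ ∑ k ∈ (S - T) \ U, h k := Finset.sum_nonneg fun k _ => hh k
    rcases hF0.eq_or_lt with hF | hF
    · rw [← hF, zero_mul, Real.zero_rpow (by linarith)]; exact hR0
    rcases hG0.eq_or_lt with hG | hG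
    · rw [← hG, mul_zero, Real.zero_rpow (by linarith)]; exact hR0
    have hSA : (S \ A).Nonempty := Finset.nonempty_of_sum_ne_zero hF.ne'
    have hTB : (T \ B).Nonempty := Finset.nonempty_of_sum_ne_zero hG.ne'
    obtain ⟨i, hi, hi'⟩ := Finset.exists_max_image (S \ A) f hSA
    obtain ⟨j, hj, hj'⟩ := Finset.exists_max_image (T \ B) g hTB
    obtain ⟨hiS, hiA⟩ := Finset.mem_sdiff.1 hi
    obtain ⟨hjT, hjB⟩ := Finset.mem_sdiff.1 hj
    have hi1 : ∀ i' ∈ insert i A, f i ≤ f i' := by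
      intro i' h'
      rcases Finset.mem_insert.1 h' with rfl | h'
      · exact le_rfl
      · exact hAf _ h' _ hi
    have hj1 : ∀ j' ∈ insert j B, g j ≤ g j' := by
      intro i' h'
      rcases Finset.mem_insert.1 h' with rfl | h'
      · exact le_rfl
      · exact hBg _ h' _ hj
    have hiS' : insert i A ⊆ S := Finset.insert_subset hiS hA
    have hjT' : insert j B ⊆ T := Finset.insert_subset hjT hB
    have hcard := card_add_card_sub_one_le_card_sub (Finset.insert_nonempty i A)
      (Finset.insert_nonempty j B)
    rw [Finset.card_insert_of_notMem hiA, Finset.card_insert_of_notMem hjB] at hcard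
    obtain ⟨k, hk, hkU⟩ := Finset.exists_mem_notMem_of_card_lt_card
      (show U.card < (insert i A - insert j B).card by omega)
    have hkh : (f i * g j) ^ τ ≤ h k := by
      obtain ⟨i', hi2, j', hj2, rfl⟩ := Finset.mem_sub.1 hk
      refine le_trans ?_ (hfg i' (hiS' hi2) j' (hjT' hj2))
      have := hf i hiS
      have := hg j hjT
      have := hi1 i' hi2
      have := hj1 j' hj2
      gcongr
      exact hf _ (hiS' hi2)
    have hkST : k ∈ (S - T) \ U :=
      Finset.mem_sdiff.2 ⟨Finset.sub_subset_sub hiS' hjT' hk, hkU⟩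
    have hsum : ∑ k ∈ (S - T) \ U, h k = h k + ∑ k ∈ (S - T) \ insert k U, h k := by
      rw [Finset.sdiff_insert, Finset.add_sum_erase _ _ hkST]
    have hsumf : ∑ i' ∈ S \ insert i A, f i' = ∑ i' ∈ S \ A, f i' - f i := by
      rw [Finset.sdiff_insert, Finset.sum_erase_eq_sub hi]
    have hsumg : ∑ i' ∈ T \ insert j B, g i' = ∑ i' ∈ T \ B, g i' - g j := by
      rw [Finset.sdiff_insert, Finset.sum_erase_eq_sub hj]
    have hM' : (0 : ℝ) < M := by exact_mod_cast hM
    have hfF : 1 / (M : ℝ) * ∑ i' ∈ S \ A, f i' ≤ f i := by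
      have h1 := Finset.sum_le_card_nsmul (S \ A) f (f i) hi'
      have h2 : ((S \ A).card : ℝ) ≤ M := by
        exact_mod_cast (Finset.card_le_card Finset.sdiff_subset).trans hS
      rw [one_div, inv_mul_le_iff₀ hM']
      rw [nsmul_eq_mul] at h1
      exact h1.trans (mul_le_mul_of_nonneg_right h2 (hf i hiS))
    have hgG : 1 / (M : ℝ) * ∑ i' ∈ T \ B, g i' ≤ g j := by
      have h1 := Finset.sum_le_card_nsmul (T \ B) g (g j) hj'
      have h2 : ((T \ B).card : ℝ) ≤ M := by
        exact_mod_cast (Finset.card_le_card Finset.sdiff_subset).trans hT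
      rw [one_div, inv_mul_le_iff₀ hM']
      rw [nsmul_eq_mul] at h1
      exact h1.trans (mul_le_mul_of_nonneg_right h2 (hg j hjT))
    have hfF' : f i ≤ ∑ i' ∈ S \ A, f i' :=
      Finset.single_le_sum (f := f) (fun i hi => hf i (Finset.mem_sdiff.1 hi).1) hi
    have hgG' : g j ≤ ∑ i' ∈ T \ B, g i' :=
      Finset.single_le_sum (f := g) (fun i hi => hg i (Finset.mem_sdiff.1 hi).1) hj
    have hc : 0 < 1 / (M : ℝ) := by positivity
    have hcS : (S \ insert i A).card + 1 = (S \ A).card := by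
      rw [Finset.sdiff_insert, Finset.card_erase_add_one hi]
    have hcT : (T \ insert j B).card + 1 = (T \ B).card := by
      rw [Finset.sdiff_insert, Finset.card_erase_add_one hj]
    rw [hsum]
    rcases le_total (f i / ∑ i' ∈ S \ A, f i') (g j / ∑ j' ∈ T \ B, g j') with hle | hle
    · refine (mul_rpow_le_add_of_div_le_div hτ hτ1 hc hτeq hF hG hfF hfF' hle).trans ?_
      refine add_le_add hkh ?_
      rw [← hsumf]
      refine ih hiS' hB ?_ (by omega) ?_ hBg
      · rw [Finset.card_insert_of_notMem hiA, Finset.card_insert_of_notMem hkU]; omega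
      · intro a ha b hb
        exact (hi' b (Finset.sdiff_subset_sdiff le_rfl (Finset.subset_insert _ _) hb)).trans
          (hi1 a ha)
    · rw [mul_comm (∑ i ∈ S \ A, f i)]
      refine (mul_rpow_le_add_of_div_le_div hτ hτ1 hc hτeq hG hF hgG hgG' hle).trans ?_
      rw [mul_comm (g j), mul_comm (_ - _)]
      refine add_le_add hkh ?_
      rw [← hsumg]
      refine ih hA hjT' ?_ (by omega) hAf ?_
      · rw [Finset.card_insert_of_notMem hjB, Finset.card_insert_of_notMem hkU]; omega
      · intro a ha b hb
        exact (hj' b (Finset.sdiff_subset_sdiff le_rfl (Finset.subset_insert _ _) hb)).trans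
          (hj1 a ha)

/-- The integers with `r` digits in base `2 * M`, all of them less than `M`. -/
def digitSet (M : ℕ) : ℕ → Set ℤ
  | 0 => {0}
  | r + 1 => {n | ∃ x m : ℤ, 0 ≤ x ∧ x < M ∧ m ∈ digitSet M r ∧ n = x + 2 * M * m}

lemma digitSet_bounds {M r : ℕ} (hM : 0 < M) {n : ℤ} (hn : n ∈ digitSet M r) :
    0 ≤ n ∧ 2 * n < (2 * M) ^ r := by
  induction r generalizing n with
  | zero => obtain rfl : n = 0 := hn; simp
  | succ r ih =>
    obtain ⟨x, m, hx0, hxM, hm, rfl⟩ := hn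
    obtain ⟨h1, h2⟩ := ih hm
    refine ⟨by positivity, ?_⟩
    have h3 : (2 * M : ℤ) * (2 * m + 1) ≤ (2 * M) * (2 * M) ^ r :=
      mul_le_mul_of_nonneg_left (by omega) (by positivity)
    rw [pow_succ']
    linarith

lemma sum_mem_digitSet {M r : ℕ} (x : Fin r → ℕ) (hx : ∀ j, x j < M) :
    ((∑ j : Fin r, x j * (2 * M) ^ (j : ℕ) : ℕ) : ℤ) ∈ digitSet M r := by
  induction r with
  | zero => simp [digitSet]
  | succ r ih =>
    refine ⟨x 0, _, by positivity, by exact_mod_cast hx 0,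
      ih (fun j => x j.succ) fun j => hx _, ?_⟩
    rw [Fin.sum_univ_succ]
    push_cast
    simp only [Fin.val_zero, pow_zero, mul_one, Fin.val_succ, pow_succ, Finset.mul_sum]
    congr 1
    exact Finset.sum_congr rfl fun j _ => by ring

/-- The quotients by `m` of the elements of `A` whose remainder modulo `m` is `x`. -/
def residueFiber (m : ℤ) (A : Finset ℤ) (x : ℤ) : Finset ℤ :=
  (A.filter fun n => n % m = x).image (· / m)

lemma card_residueFiber (m : ℤ) (A : Finset ℤ) (x : ℤ) :
    (residueFiber m A x).card = (A.filter fun n => n % m = x).card := by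
  refine Finset.card_image_of_injOn fun a ha b hb hab => ?_
  simp only [Finset.coe_filter, Set.mem_ofPred_eq] at ha hb hab
  rw [← Int.emod_add_mul_ediv a m, ← Int.emod_add_mul_ediv b m, ha.2, hb.2, hab]

lemma add_mul_mem_of_mem_residueFiber {m x n : ℤ} {A : Finset ℤ} (hn : n ∈ residueFiber m A x) :
    x + m * n ∈ A := by
  simp only [residueFiber, Finset.mem_image, Finset.mem_filter] at hn
  obtain ⟨a, ⟨ha, rfl⟩, rfl⟩ := hn
  rwa [Int.emod_add_mul_ediv]

lemma emod_and_ediv_of_mem_digitSet_succ {M r : ℕ} {n : ℤ} (hn : n ∈ digitSet M (r + 1)) :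
    n % (2 * M) ∈ Finset.Ico (0 : ℤ) M ∧ n / (2 * M) ∈ digitSet M r := by
  obtain ⟨x, m, hx0, hxM, hm, rfl⟩ := hn
  have h1 : x % (2 * M) = x := Int.emod_eq_of_lt hx0 (by omega)
  have h2 : x / (2 * M) = 0 := Int.ediv_eq_zero_of_lt hx0 (by omega)
  rw [Int.add_mul_emod_self_left, Int.add_mul_ediv_left _ _ (by omega), h1, h2, zero_add]
  exact ⟨Finset.mem_Ico.2 ⟨hx0, hxM⟩, hm⟩

lemma residueFiber_subset_digitSet {M r : ℕ} {A : Finset ℤ} (hA : ↑A ⊆ digitSet M (r + 1))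
    (x : ℤ) : ↑(residueFiber (2 * M) A x) ⊆ digitSet M r := by
  intro n hn
  simp only [residueFiber, Finset.coe_image, Set.mem_image, Finset.coe_filter,
    Set.mem_ofPred_eq] at hn
  obtain ⟨a, ⟨ha, -⟩, rfl⟩ := hn
  exact (emod_and_ediv_of_mem_digitSet_succ (hA ha)).2

lemma sum_card_residueFiber {M r : ℕ} {A : Finset ℤ} (hA : ↑A ⊆ digitSet M (r + 1)) :
    ∑ x ∈ Finset.Ico (0 : ℤ) M, (residueFiber (2 * M) A x).card = A.card := by
  rw [Finset.card_eq_sum_card_fiberwise (f := fun n => n % (2 * M : ℤ))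
    fun a ha => (emod_and_ediv_of_mem_digitSet_succ (hA ha)).1]
  exact Finset.sum_congr rfl fun x _ => card_residueFiber _ _ _

lemma card_sub_residueFiber_le (m : ℤ) (hm : 0 < m) (A B : Finset ℤ) (x y : ℤ) :
    (residueFiber m A x - residueFiber m B y).card ≤
      ((A - B).filter fun n => n % m = (x - y) % m).card := by
  refine Finset.card_le_card_of_injOn (fun d => x - y + m * d) (fun d hd => ?_) ?_
  · obtain ⟨a, ha, b, hb, rfl⟩ := Finset.mem_sub.1 hd
    simp only [Finset.coe_filter, Set.mem_ofPred_eq]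
    refine ⟨Finset.mem_sub.2 ⟨_, add_mul_mem_of_mem_residueFiber ha, _,
      add_mul_mem_of_mem_residueFiber hb, by ring⟩, by rw [Int.add_mul_emod_self_left]⟩
  · intro a _ b _ hab
    simpa [hm.ne'] using hab

lemma sum_card_filter_emod_le {M : ℕ} (C : Finset ℤ) :
    ∑ k ∈ Finset.Ico (0 : ℤ) M - Finset.Ico (0 : ℤ) M,
      (C.filter fun n => n % (2 * M : ℤ) = k % (2 * M)).card ≤ C.card := by
  rw [← Finset.card_biUnion]
  · exact Finset.card_le_card (Finset.biUnion_subset.2 fun k _ => Finset.filter_subset _ _)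
  · intro k hk l hl hkl
    rw [Function.onFun, Finset.disjoint_left]
    intro n hn hn'
    obtain ⟨a, ha, b, hb, rfl⟩ := Finset.mem_sub.1 hk
    obtain ⟨c, hc, d, hd, rfl⟩ := Finset.mem_sub.1 hl
    simp only [Finset.mem_Ico, Finset.mem_filter] at *
    refine hkl ?_
    have h1 : (2 * M : ℤ) ∣ (a - b) - (c - d) :=
      Int.ModEq.dvd (hn'.2.symm.trans hn.2)
    have := Int.eq_zero_of_abs_lt_dvd h1 (by rw [abs_lt]; constructor <;> linarith)
    linarith

lemma rpow_card_mul_card_le_card_sub {τ : ℝ} {M : ℕ} (hM : 0 < M) (hτ : 1 / 2 ≤ τ) (hτ1 : τ ≤ 1)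
    (hτeq : (1 / (M : ℝ)) ^ (2 * τ) + (1 - 1 / (M : ℝ)) ^ τ = 1) {r : ℕ} {A B : Finset ℤ}
    (hA : ↑A ⊆ digitSet M r) (hB : ↑B ⊆ digitSet M r) :
    ((A.card : ℝ) * B.card) ^ τ ≤ (A - B).card := by
  induction r generalizing A B with
  | zero =>
    rcases A.eq_empty_or_nonempty with rfl | hA'
    · simp [Real.zero_rpow (show τ ≠ 0 by linarith)]
    rcases B.eq_empty_or_nonempty with rfl | hB'
    · simp [Real.zero_rpow (show τ ≠ 0 by linarith)]
    have h1 : A.card ≤ 1 := Finset.card_le_one.2 fun a ha b hb => (hA ha).trans (hA hb).symm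
    have h2 : B.card ≤ 1 := Finset.card_le_one.2 fun a ha b hb => (hB ha).trans (hB hb).symm
    have h3 : A.card * B.card ≤ 1 := Nat.mul_le_mul h1 h2
    have h4 : 1 ≤ (A - B).card := (hA'.sub hB').card_pos
    calc ((A.card : ℝ) * B.card) ^ τ ≤ 1 :=
          Real.rpow_le_one (by positivity) (by exact_mod_cast h3) (by linarith)
      _ ≤ _ := by exact_mod_cast h4
  | succ r ih =>
    have key := rpow_sum_mul_sum_le_sum_sdiff_s13 hM hτ hτ1 hτeq
      (S := Finset.Ico (0 : ℤ) M) (T := Finset.Ico (0 : ℤ) M) (by simp) (by simp)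
      (f := fun x => (residueFiber (2 * M) A x).card)
      (g := fun x => (residueFiber (2 * M) B x).card)
      (h := fun k => ((A - B).filter fun n => n % (2 * M : ℤ) = k % (2 * M)).card)
      (fun _ _ => by positivity) (fun _ _ => by positivity) (fun _ => by positivity)
      (fun x _ y _ => (ih (residueFiber_subset_digitSet hA x)
        (residueFiber_subset_digitSet hB y)).trans (by
          exact_mod_cast card_sub_residueFiber_le (2 * M) (by positivity) A B x y))
      _ (A := ∅) (B := ∅) (U := ∅) (by simp) (by simp) (by simp) rfl (by simp) (by simp)
    simp only [Finset.sdiff_empty] at key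
    have h1 := sum_card_residueFiber hA
    have h2 := sum_card_residueFiber hB
    have h3 := sum_card_filter_emod_le (M := M) (A - B)
    rw [← h1, ← h2]
    push_cast
    exact key.trans (by exact_mod_cast h3)

lemma exists_digitSet_lift {M r p : ℕ} {B : Finset (ZMod p)} (hB : B ⊆ Bset M r p) :
    ∃ A : Finset ℤ, ↑A ⊆ digitSet M r ∧ A.image (Int.cast : ℤ → ZMod p) = B := by
  have h : ↑B ⊆ (Int.cast : ℤ → ZMod p) '' digitSet M r := by
    intro b hb
    obtain ⟨x, hx, rfl⟩ := Finset.mem_image.1 (hB hb)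
    exact ⟨_, sum_mem_digitSet x fun j => Finset.mem_range.1 (Fintype.mem_piFinset.1 hx j),
      by push_cast; rfl⟩
  obtain ⟨A, hA, hAB⟩ := Finset.subset_set_image_iff.1 h
  exact ⟨A, hA, hAB⟩

lemma card_image_intCast_sub {M r p : ℕ} (hM : 0 < M) (hrp : (2 * M) ^ r ≤ p) {A : Finset ℤ}
    (hA : ↑A ⊆ digitSet M r) :
    (A.image (Int.cast : ℤ → ZMod p) - A.image (Int.cast : ℤ → ZMod p)).card = (A - A).card := by
  have himg : A.image (Int.cast : ℤ → ZMod p) - A.image (Int.cast : ℤ → ZMod p) =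
      (A - A).image (Int.cast : ℤ → ZMod p) :=
    (Finset.image_image₂_distrib fun a b => Int.cast_sub a b).symm
  have hrp' : (2 * M : ℤ) ^ r ≤ p := by exact_mod_cast hrp
  rw [himg]
  refine Finset.card_image_of_injOn fun u hu v hv huv => ?_
  obtain ⟨a, ha, b, hb, rfl⟩ := Finset.mem_sub.1 hu
  obtain ⟨c, hc, d, hd, rfl⟩ := Finset.mem_sub.1 hv
  have := digitSet_bounds hM (hA ha)
  have := digitSet_bounds hM (hA hb)
  have := digitSet_bounds hM (hA hc)
  have := digitSet_bounds hM (hA hd)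
  have h1 : (p : ℤ) ∣ (a - b) - (c - d) :=
    (ZMod.intCast_eq_intCast_iff_dvd_sub _ _ _).1 huv.symm
  have := Int.eq_zero_of_abs_lt_dvd h1 (by rw [abs_lt]; constructor <;> linarith)
  linarith

theorem card_diffset_gt_of_card_gt (M r p : ℕ) (hM : 2 ≤ M) (hr : 1 ≤ r)
    (hp : p.Prime) (hrp : (2 * M) ^ r ≤ p) (τ : ℝ) (hτ : 0 < τ)
    (hτeq : (1 / (M : ℝ)) ^ (2 * τ) + (((M : ℝ) - 1) / (M : ℝ)) ^ τ = 1)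
    (s t : ℝ) (hs : 0 < s) (ht : 0 < t) (hst : t ≤ (2 * τ - 1) * s) :
    ∀ B ⊆ Bset M r p, (p : ℝ) ^ s < (B.card : ℝ) →
      (p : ℝ) ^ t * (B.card : ℝ) < ((B - B).card : ℝ) := by
  intro B hB hcard
  have hM0 : 0 < M := by omega
  have hM1 : (1 : ℝ) < M := by exact_mod_cast hM
  have hMR : (0 : ℝ) < M := by linarith
  rw [sub_div, div_self hMR.ne'] at hτeq
  have hτ2 : 0 < 2 * τ - 1 := pos_of_mul_pos_left (ht.trans_le hst) hs.le
  have hτ1 := lt_one_of_rpow_add_rpow_eq_one (one_div_pos.2 hMR)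
    ((div_lt_one hMR).2 hM1) hτeq
  obtain ⟨A, hA, rfl⟩ := exists_digitSet_lift hB
  rw [card_image_intCast_sub hM0 hrp hA]
  have hp1 : (1 : ℝ) ≤ p := by exact_mod_cast hp.one_le
  have hp0 : (0 : ℝ) < p := by linarith
  have hAcard : ((A.image (Int.cast : ℤ → ZMod p)).card : ℝ) ≤ A.card := by
    exact_mod_cast Finset.card_image_le
  set a : ℝ := (A.card : ℝ)
  have hpa : (p : ℝ) ^ s < a := hcard.trans_le hAcard
  have ha : 0 < a := (Real.rpow_pos_of_pos hp0 s).trans hpa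
  calc (p : ℝ) ^ t * ((A.image (Int.cast : ℤ → ZMod p)).card : ℝ) ≤ (p : ℝ) ^ t * a := by gcongr
    _ ≤ ((p : ℝ) ^ s) ^ (2 * τ - 1) * a := by
        rw [← Real.rpow_mul hp0.le, mul_comm s]
        gcongr
    _ < a ^ (2 * τ - 1) * a := by gcongr
    _ = (a * a) ^ τ := by
        rw [← Real.rpow_add_one ha.ne', sub_add_cancel, Real.rpow_mul ha.le, Real.rpow_two, sq]
    _ ≤ _ := rpow_card_mul_card_le_card_sub hM0 (by linarith) hτ1.le hτeq hA hA
end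

section
/- For every integer m ≥ 1 there exists P such that for every prime p ≥ P the following holds. Set α := 1/(2m(4m−1)), L := ⌊p^α⌋, U := ⌊L^{4m−1}⌋, and 𝒜 := {x²+Ux mod p : x ∈ {1,…,L}} ⊆ F_p. Then: (i) the map x ↦ x²+Ux mod p is injective on {1,…,L}, so |𝒜| = L, and (1/2)·p^α ≤ |𝒜| ≤ p^α; (ii) for every a ∈ 𝒜 and a₁,…,a_{2m} ∈ 𝒜∖{a}, if Σ_{j=1}^m (a−a_j)^{−1} = Σ_{j=m+1}^{2m} (a−a_j)^{−1} in F_p, then the tuples (a₁,…,a_m) and (a_{m+1},…,a_{2m}) are permutations of each other (i.e. they coincide as multisets). -/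
open scoped BigOperators

/-- `α = 1/(2m(4m−1))`. -/
noncomputable def alphaOf (m : ℕ) : ℝ := 1 / (2 * m * (4 * m - 1))

/-- `L = ⌊p^α⌋`. -/
noncomputable def LOf (m p : ℕ) : ℕ := ⌊(p : ℝ) ^ alphaOf m⌋₊

/-- `U = ⌊L^{4m−1}⌋ = L^{4m−1}`. -/
noncomputable def UOf (m p : ℕ) : ℕ := LOf m p ^ (4 * m - 1)

/-- `𝒜 = {x² + Ux mod p : 1 ≤ x ≤ L}`. -/
noncomputable def AsetOf (m p : ℕ) : Finset (ZMod p) :=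
  (Finset.Icc 1 (LOf m p)).image fun x : ℕ => ((x ^ 2 + UOf m p * x : ℕ) : ZMod p)

lemma Multiset.sum_map_eq_sum_count {ι K : Type*} [DecidableEq ι] [CommRing K] (Y : Multiset ι)
    {S : Finset ι} (hS : Y.toFinset ⊆ S) (φ : ι → K) :
    (Y.map φ).sum = ∑ i ∈ S, (Y.count i : K) * φ i := by
  rw [Finset.sum_multiset_map_count]
  simp only [nsmul_eq_mul]
  refine Finset.sum_subset hS fun i _ hi => ?_
  rw [Multiset.count_eq_zero_of_notMem (by simpa using hi)]
  simp

lemma Finset.sum_mul_prod_erase_eq_zero {ι K : Type*} [DecidableEq ι] [Field K] (S : Finset ι)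
    (c d : ι → K) (hd : ∀ i ∈ S, d i ≠ 0) (h : ∑ i ∈ S, c i * (d i)⁻¹ = 0) :
    ∑ i ∈ S, c i * ∏ k ∈ S.erase i, d k = 0 := by
  have := congrArg (· * ∏ k ∈ S, d k) h
  simp only [zero_mul, Finset.sum_mul] at this
  rw [← this]
  refine Finset.sum_congr rfl fun i hi => ?_
  rw [← Finset.mul_prod_erase S d hi, mul_assoc, inv_mul_cancel_left₀ (hd i hi)]

/-- Modulo `x + i + U`, only the `i`-th summand survives, and there `x + k + U ≡ k - i`. -/
lemma dvd_of_sum_mul_prod_erase_eq_zero (S : Finset ℕ) (c : ℕ → ℤ) (x U : ℤ)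
    (h : ∑ i ∈ S, c i * ∏ k ∈ S.erase i, ((x - k) * (x + k + U)) = 0) {i : ℕ} (hi : i ∈ S) :
    x + i + U ∣ c i * ∏ k ∈ S.erase i, ((x - k) * (k - i)) := by
  rw [← Finset.add_sum_erase _ _ hi] at h
  have h1 : x + i + U ∣
      ∑ j ∈ S.erase i, c j * ∏ k ∈ S.erase j, ((x - k) * (x + k + U)) := by
    refine Finset.dvd_sum fun j hj => Dvd.dvd.mul_left ?_ _
    have hij : i ∈ S.erase j := Finset.mem_erase.2 ⟨(Finset.ne_of_mem_erase hj).symm, hi⟩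
    exact (Dvd.intro_left _ rfl).trans (Finset.dvd_prod_of_mem _ hij)
  have h2 : x + i + U ∣ c i * ∏ k ∈ S.erase i, ((x - k) * (x + k + U)) :=
    (dvd_add_left h1).1 (h ▸ dvd_zero _)
  have h3 : ∏ k ∈ S.erase i, ((x - k) * (k - i)) ≡
      ∏ k ∈ S.erase i, ((x - k) * (x + k + U)) [ZMOD x + i + U] := by
    refine Int.ModEq.prod fun k _ => Int.ModEq.mul_left _ ?_
    exact Int.modEq_iff_dvd.2 ⟨1, by ring⟩
  exact (h3.mul_left (c i)).dvd_iff.2 h2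

lemma Finset.abs_prod_le_pow {ι : Type*} (S : Finset ι) (f : ι → ℤ) {B : ℤ} {n : ℕ} (hB : 1 ≤ B)
    (hn : S.card ≤ n) (hf : ∀ i ∈ S, |f i| ≤ B) : |∏ i ∈ S, f i| ≤ B ^ n := by
  rw [Finset.abs_prod]
  calc ∏ i ∈ S, |f i| ≤ ∏ _i ∈ S, B := Finset.prod_le_prod (fun _ _ => abs_nonneg _) hf
    _ = B ^ S.card := by simp
    _ ≤ B ^ n := pow_le_pow_right₀ hB hn

lemma exists_perm_of_map_univ_eq {ι κ : Type*} [Fintype ι] [DecidableEq κ] {y z : ι → κ}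
    (h : Finset.univ.val.map y = Finset.univ.val.map z) :
    ∃ σ : Equiv.Perm ι, ∀ j, y j = z (σ j) := by
  have e : ∀ i, Nonempty ({j // y j = i} ≃ {j // z j = i}) := by
    intro i
    have hi := congrArg (Multiset.count i) h
    rw [Multiset.count_map, Multiset.count_map] at hi
    refine ⟨Fintype.equivOfCardEq ?_⟩
    rw [Fintype.card_subtype, Fintype.card_subtype]
    simpa only [eq_comm (a := i), ← Finset.filter_val, Finset.card_val] using hi
  exact ⟨Equiv.ofFiberEquiv fun i => (e i).some, fun j => (Equiv.ofFiberEquiv_map _ j).symm⟩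

lemma Multiset.eq_of_sum_inv_eq {m L p : ℕ} [Fact p.Prime] (hm : 1 ≤ m) (hL : 6 * m ≤ L)
    (hp : L ^ (2 * m * (4 * m - 1)) ≤ p) {x : ℕ} (hx : x ∈ Finset.Icc 1 L) {Y Z : Multiset ℕ}
    (hY : Y.card = m) (hZ : Z.card = m)
    (hYL : ∀ i ∈ Y, i ∈ Finset.Icc 1 L) (hZL : ∀ i ∈ Z, i ∈ Finset.Icc 1 L)
    (d : ℕ → ℤ) (hd : ∀ i, d i = ((x : ℤ) - i) * (x + i + (L : ℤ) ^ (4 * m - 1)))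
    (hY0 : ∀ i ∈ Y, (d i : ZMod p) ≠ 0) (hZ0 : ∀ i ∈ Z, (d i : ZMod p) ≠ 0)
    (h : (Y.map fun i => (d i : ZMod p)⁻¹).sum = (Z.map fun i => (d i : ZMod p)⁻¹).sum) :
    Y = Z := by
  set U : ℤ := (L : ℤ) ^ (4 * m - 1) with hU
  set S : Finset ℕ := Y.toFinset ∪ Z.toFinset with hS
  have hSL : ∀ i ∈ S, 1 ≤ i ∧ i ≤ L := by
    intro i hi
    rw [hS, Finset.mem_union, Multiset.mem_toFinset, Multiset.mem_toFinset] at hi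
    exact Finset.mem_Icc.1 (hi.elim (hYL i) (hZL i))
  have hS0 : ∀ i ∈ S, (d i : ZMod p) ≠ 0 := by
    intro i hi
    rw [hS, Finset.mem_union, Multiset.mem_toFinset, Multiset.mem_toFinset] at hi
    exact hi.elim (hY0 i) (hZ0 i)
  have hSx : ∀ i ∈ S, (x : ℤ) - i ≠ 0 := fun i hi h0 => hS0 i hi (by simp [hd, h0])
  have hcard : S.card ≤ 2 * m := by
    have : S.card ≤ _ := Finset.card_union_le Y.toFinset Z.toFinset
    have := Y.toFinset_card_le
    have := Z.toFinset_card_le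
    omega
  have hcard' : ∀ i ∈ S, (S.erase i).card ≤ 2 * m - 1 := by
    intro i hi
    rw [Finset.card_erase_of_mem hi]
    omega
  have hx' := Finset.mem_Icc.1 hx
  have hL0 : (1 : ℤ) ≤ L := by omega
  have hUL : (L : ℤ) ≤ U := by
    rw [hU]
    exact le_self_pow₀ hL0 (by omega)
  set c : ℕ → ℤ := fun i => (Y.count i : ℤ) - Z.count i with hc
  have hcm : ∀ i, |c i| ≤ m := by
    intro i
    have := Multiset.count_le_card i Y
    have := Multiset.count_le_card i Z
    rw [abs_le]
    simp only [hc]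
    omega
  have hN : ∑ i ∈ S, c i * ∏ k ∈ S.erase i, d k = 0 := by
    apply Int.eq_zero_of_abs_lt_dvd (m := p)
    · rw [← ZMod.intCast_zmod_eq_zero_iff_dvd]
      push_cast
      refine Finset.sum_mul_prod_erase_eq_zero S _ _ hS0 ?_
      rw [Y.sum_map_eq_sum_count Finset.subset_union_left,
        Z.sum_map_eq_sum_count Finset.subset_union_right, ← sub_eq_zero,
        ← Finset.sum_sub_distrib] at h
      rw [← h]
      refine Finset.sum_congr rfl fun i _ => ?_
      simp only [hc]
      push_cast
      ring
    · have hdB : ∀ i ∈ S, |d i| ≤ 3 * (L * U) := by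
        intro i hi
        have := hSL i hi
        rw [hd, abs_mul]
        calc |(x : ℤ) - i| * |x + i + U| ≤ L * (3 * U) := by
              refine mul_le_mul (abs_le.2 ⟨by omega, by omega⟩) ?_ (abs_nonneg _) (by omega)
              exact abs_le.2 ⟨by omega, by omega⟩
          _ = 3 * (L * U) := by ring
      have hB : (1 : ℤ) ≤ 3 * (L * U) := by nlinarith
      calc |∑ i ∈ S, c i * ∏ k ∈ S.erase i, d k|
          ≤ ∑ i ∈ S, |c i * ∏ k ∈ S.erase i, d k| := Finset.abs_sum_le_sum_abs _ _
        _ ≤ ∑ i ∈ S, m * (3 * (L * U)) ^ (2 * m - 1) := by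
            refine Finset.sum_le_sum fun i hi => ?_
            rw [abs_mul]
            exact mul_le_mul (hcm i) ((S.erase i).abs_prod_le_pow _ hB (hcard' i hi)
              fun k hk => hdB k (Finset.mem_of_mem_erase hk)) (abs_nonneg _) (by positivity)
        _ = S.card * (m * (3 * (L * U)) ^ (2 * m - 1)) := by simp
        _ ≤ (2 * m : ℕ) * (m * (3 * (L * U)) ^ (2 * m - 1)) := by gcongr
        _ < (L : ℤ) ^ (2 * m) * ((L * U) ^ (2 * m - 1)) := by
            rw [mul_pow, ← mul_assoc, ← mul_assoc]
            refine mul_lt_mul_of_pos_right ?_ (by positivity)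
            obtain ⟨n, rfl⟩ := Nat.exists_eq_add_of_le' hm
            have e1 : 2 * (n + 1) - 1 = 2 * n + 1 := by omega
            have e2 : 2 * (n + 1) = 2 * n + 1 + 1 := by omega
            have hL6 : 6 * ((n + 1 : ℕ) : ℤ) ≤ L := by exact_mod_cast hL
            have hn0 : (1 : ℤ) ≤ ((n + 1 : ℕ) : ℤ) := by omega
            have h3 : (3 * ((n + 1 : ℕ) : ℤ)) ^ (2 * n + 1) ≤ (L : ℤ) ^ (2 * n + 1) := by
              gcongr
              omega
            have h4 : ((n + 1 : ℕ) : ℤ) ≤ ((n + 1 : ℕ) : ℤ) ^ (2 * n + 1) :=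
              le_self_pow₀ hn0 (by omega)
            rw [e1, e2, pow_succ (L : ℤ)]
            rw [mul_pow] at h3
            have h5 : (3 : ℤ) ^ (2 * n + 1) * ((n + 1 : ℕ) : ℤ) ≤ (L : ℤ) ^ (2 * n + 1) :=
              (mul_le_mul_of_nonneg_left h4 (by positivity)).trans h3
            have h6 : ((2 * n + 1 + 1 : ℕ) : ℤ) < L := by omega
            calc ((2 * n + 1 + 1 : ℕ) : ℤ) * ((n + 1 : ℕ) : ℤ) * 3 ^ (2 * n + 1)
                = (3 ^ (2 * n + 1) * ((n + 1 : ℕ) : ℤ)) * ((2 * n + 1 + 1 : ℕ) : ℤ) := by ring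
              _ < (3 ^ (2 * n + 1) * ((n + 1 : ℕ) : ℤ)) * L :=
                  mul_lt_mul_of_pos_left h6 (by positivity)
              _ ≤ _ := mul_le_mul_of_nonneg_right h5 (by positivity)
        _ = (L : ℤ) ^ (2 * m * (4 * m - 1)) := by
            rw [hU, ← pow_succ', ← pow_mul, ← pow_add]
            congr 1
            obtain ⟨n, rfl⟩ := Nat.exists_eq_add_of_le' hm
            have e1 : 2 * (n + 1) - 1 = 2 * n + 1 := by omega
            have e2 : 4 * (n + 1) - 1 = 4 * n + 3 := by omega
            rw [e1, e2]
            ring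
        _ ≤ p := by exact_mod_cast hp
  have hc0 : ∀ i ∈ S, c i = 0 := by
    intro i hi
    have hi' := hSL i hi
    simp only [hd] at hN
    have hdvd := dvd_of_sum_mul_prod_erase_eq_zero S c x U hN hi
    have hprod : ∏ k ∈ S.erase i, (((x : ℤ) - k) * (k - i)) ≠ 0 := by
      refine Finset.prod_ne_zero_iff.2 fun k hk => mul_ne_zero (hSx k (Finset.mem_of_mem_erase hk)) ?_
      have := Finset.ne_of_mem_erase hk
      omega
    refine (mul_eq_zero.1 (Int.eq_zero_of_abs_lt_dvd hdvd ?_)).resolve_right hprod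
    have hLL : (1 : ℤ) ≤ L * L := by nlinarith
    rw [abs_mul]
    calc |c i| * |∏ k ∈ S.erase i, (((x : ℤ) - k) * (k - i))|
        ≤ L * (L * L) ^ (2 * m - 1) := by
          refine mul_le_mul ((hcm i).trans (by omega)) ?_ (abs_nonneg _) (by omega)
          refine (S.erase i).abs_prod_le_pow _ hLL (hcard' i hi) fun k hk => ?_
          have := hSL k (Finset.mem_of_mem_erase hk)
          rw [abs_mul]
          exact mul_le_mul (abs_le.2 ⟨by omega, by omega⟩) (abs_le.2 ⟨by omega, by omega⟩)
            (abs_nonneg _) (by omega)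
      _ = U := by
          rw [← pow_two, ← pow_mul, ← pow_succ', hU]
          congr 1
          omega
      _ < x + i + U := by omega
  ext i
  by_cases hi : i ∈ S
  · have := hc0 i hi
    simp only [hc] at this
    omega
  · rw [hS, Finset.mem_union, Multiset.mem_toFinset, Multiset.mem_toFinset, not_or] at hi
    rw [Multiset.count_eq_zero_of_notMem hi.1, Multiset.count_eq_zero_of_notMem hi.2]

lemma injOn_sq_add_mul {m L p : ℕ} (hp : p.Prime) (hm : 1 ≤ m) (hL : 6 * m ≤ L)
    (hLp : L ^ (2 * m * (4 * m - 1)) ≤ p) :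
    Set.InjOn (fun x : ℕ => ((x ^ 2 + L ^ (4 * m - 1) * x : ℕ) : ZMod p))
      (Finset.Icc 1 L : Set ℕ) := by
  intro x hx y hy hxy
  rw [Finset.mem_coe, Finset.mem_Icc] at hx hy
  set U : ℕ := L ^ (4 * m - 1) with hU
  have hUL : L ≤ U := Nat.le_self_pow (by omega) L
  have hUp : U * U ≤ p := by
    refine le_trans ?_ hLp
    rw [hU, ← pow_two, ← pow_mul]
    exact Nat.pow_le_pow_right (by omega) (by nlinarith [Nat.zero_le (4 * m - 1)])
  have hU3 : 3 * U < p := by nlinarith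
  have hdvd : (p : ℤ) ∣ ((x : ℤ) - y) * (x + y + U) := by
    rw [← ZMod.intCast_zmod_eq_zero_iff_dvd]
    push_cast at hxy ⊢
    linear_combination hxy
  rcases (Nat.prime_iff_prime_int.1 hp).dvd_or_dvd hdvd with h | h
  · have := Int.eq_zero_of_abs_lt_dvd h (abs_lt.2 ⟨by omega, by omega⟩)
    omega
  · have := Int.eq_zero_of_abs_lt_dvd h (abs_lt.2 ⟨by omega, by omega⟩)
    omega

lemma LOf_pow_le {m : ℕ} (hm : 1 ≤ m) (p : ℕ) : LOf m p ^ (2 * m * (4 * m - 1)) ≤ p := by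
  have h0 : (0 : ℝ) ≤ (p : ℝ) ^ alphaOf m := by positivity
  have h1 : (LOf m p : ℝ) ≤ (p : ℝ) ^ alphaOf m := Nat.floor_le h0
  have hcast : ((2 * m * (4 * m - 1) : ℕ) : ℝ) = 2 * m * (4 * m - 1) := by
    rw [Nat.cast_mul, Nat.cast_sub (by omega)]
    push_cast
    ring
  have hm' : (1 : ℝ) ≤ m := by exact_mod_cast hm
  have hne : (2 * m * (4 * m - 1) : ℝ) ≠ 0 := by
    have : (0 : ℝ) < 4 * m - 1 := by linarith
    positivity
  have h2 : ((LOf m p : ℝ)) ^ (2 * m * (4 * m - 1)) ≤ p := by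
    calc (LOf m p : ℝ) ^ (2 * m * (4 * m - 1))
        ≤ ((p : ℝ) ^ alphaOf m) ^ (2 * m * (4 * m - 1)) := by gcongr
      _ = p := by
        rw [← Real.rpow_natCast, ← Real.rpow_mul (by positivity), hcast, alphaOf,
          one_div_mul_cancel hne, Real.rpow_one]
  exact_mod_cast h2

lemma tendsto_LOf_atTop {m : ℕ} (hm : 1 ≤ m) :
    Filter.Tendsto (LOf m) Filter.atTop Filter.atTop := by
  have hm' : (1 : ℝ) ≤ m := by exact_mod_cast hm
  have hα : 0 < alphaOf m := by
    have : (0 : ℝ) < 4 * m - 1 := by linarith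
    unfold alphaOf
    positivity
  exact tendsto_nat_floor_atTop.comp ((tendsto_rpow_atTop hα).comp tendsto_natCast_atTop_atTop)

theorem Aset_construction (m : ℕ) (hm : 1 ≤ m) :
    ∃ P : ℕ, ∀ p : ℕ, P ≤ p → p.Prime →
      (Set.InjOn (fun x : ℕ => ((x ^ 2 + UOf m p * x : ℕ) : ZMod p))
          (Finset.Icc 1 (LOf m p) : Set ℕ) ∧
        (AsetOf m p).card = LOf m p ∧
        (1 / 2 : ℝ) * (p : ℝ) ^ alphaOf m ≤ ((AsetOf m p).card : ℝ) ∧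
        ((AsetOf m p).card : ℝ) ≤ (p : ℝ) ^ alphaOf m) ∧
      (∀ a ∈ AsetOf m p, ∀ f g : Fin m → ZMod p,
        (∀ j, f j ∈ AsetOf m p ∧ f j ≠ a) → (∀ j, g j ∈ AsetOf m p ∧ g j ≠ a) →
        ∑ j, (a - f j)⁻¹ = ∑ j, (a - g j)⁻¹ →
        ∃ σ : Equiv.Perm (Fin m), ∀ j, f j = g (σ j)) := by
  obtain ⟨P, hP⟩ := Filter.eventually_atTop.1
    ((tendsto_LOf_atTop hm).eventually_ge_atTop (6 * m))
  refine ⟨P, fun p hPp hp => ?_⟩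
  have : Fact p.Prime := ⟨hp⟩
  have hL := hP p hPp
  have hLp := LOf_pow_le hm p
  have hinj : Set.InjOn (fun x : ℕ => ((x ^ 2 + UOf m p * x : ℕ) : ZMod p))
      (Finset.Icc 1 (LOf m p) : Set ℕ) := injOn_sq_add_mul hp hm hL hLp
  have hcard : (AsetOf m p).card = LOf m p := by
    rw [AsetOf, Finset.card_image_of_injOn hinj, Nat.card_Icc, Nat.add_sub_cancel]
  refine ⟨⟨hinj, hcard, ?_, ?_⟩, ?_⟩
  · have h1 : (p : ℝ) ^ alphaOf m < LOf m p + 1 := Nat.lt_floor_add_one _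
    have h2 : (1 : ℝ) ≤ LOf m p := by exact_mod_cast (by omega : 1 ≤ LOf m p)
    rw [hcard]
    linarith
  · rw [hcard]
    exact Nat.floor_le (by positivity)
  · intro a ha f g hf hg hfg
    obtain ⟨x, hx, rfl⟩ := Finset.mem_image.1 ha
    choose y hy hyf using fun j => Finset.mem_image.1 (hf j).1
    choose z hz hzg using fun j => Finset.mem_image.1 (hg j).1
    set d : ℕ → ℤ := fun i => ((x : ℤ) - i) * (x + i + (LOf m p : ℤ) ^ (4 * m - 1)) with hd
    have hdiff : ∀ i : ℕ, (d i : ZMod p) =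
        ((x ^ 2 + UOf m p * x : ℕ) : ZMod p) - ((i ^ 2 + UOf m p * i : ℕ) : ZMod p) := by
      intro i
      simp only [hd, UOf]
      push_cast
      ring
    have hYZ : Finset.univ.val.map y = Finset.univ.val.map z := by
      refine Multiset.eq_of_sum_inv_eq hm hL hLp hx (by simp) (by simp) ?_ ?_ d (fun _ => rfl)
        ?_ ?_ ?_
      · simpa using hy
      · simpa using hz
      · simp only [Multiset.mem_map, Finset.mem_val, Finset.mem_univ, true_and,
          forall_exists_index, forall_apply_eq_imp_iff]
        intro j
        rw [hdiff, hyf]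
        exact sub_ne_zero.2 (hf j).2.symm
      · simp only [Multiset.mem_map, Finset.mem_val, Finset.mem_univ, true_and,
          forall_exists_index, forall_apply_eq_imp_iff]
        intro j
        rw [hdiff, hzg]
        exact sub_ne_zero.2 (hg j).2.symm
      · simp only [Multiset.map_map, Function.comp_def, hdiff, hyf, hzg]
        exact hfg
    obtain ⟨σ, hσ⟩ := exists_perm_of_map_univ_eq hYZ
    refine ⟨σ, fun j => ?_⟩
    rw [← (hyf j), ← (hzg (σ j)), hσ]
end
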